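/- Let d ≥ 2, q ≥ 2, α > d, J > 0, and let h = (h_{x,n})_{x∈ℤ^d, n∈ZMod q} be a family of nonnegative real numbers. (i) If there exist h* ≥ 0 and δ > min(α−d, 1) such that h_{x,n} ≤ h*/|x|^δ for every x ≠ 0 and every n ∈ ZMod q, then there exists β₀ > 0 such that for every β > β₀ the long-range Potts model with external field h undergoes phase transition: the set 𝒢_{β,h} of all weak cluster points of the nets of finite-volume Gibbs measures, over all boundary conditions, contains at least two distinct probability measures. (ii) If instead h_{x,n} ≤ h*/|x|^{min(α−d,1)} for every x ≠ 0 and n, then there exists h₀ > 0 such that the same conclusion holds for all h* ≤ h₀ and all β large enough. -/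

import Mathlib

open scoped BigOperators
open Filter MeasureTheory

noncomputable section

/-- The lattice `ℤ^d`. -/
abbrev Zd (d : ℕ) := Fin d → ℤ

/-- The ℓ¹-norm on `ℤ^d`. -/
def l1 {d : ℕ} (x : Zd d) : ℤ := ∑ i, |x i|

/-- The configuration in `Ω_Λ^η` determined by `σ : Λ → ZMod q` (boundary condition `η`). -/
def extendCfg {d q : ℕ} (Λ : Finset (Zd d)) (η : Zd d → ZMod q) (σ : Λ → ZMod q) :
    Zd d → ZMod q :=
  fun x => if hx : x ∈ Λ then σ ⟨x, hx⟩ else η x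

/-- The Potts Hamiltonian with external field `h` and boundary condition `η`:
`H^η_{Λ,h}(σ) = -∑_{{x,y}⊆Λ} J_{xy}·𝟙[σ_x=σ_y] - ∑_{x∈Λ}∑_{y∉Λ} J_{xy}·𝟙[σ_x=η_y] - ∑_{x∈Λ} h_{x,σ_x}`.
(The sum over unordered pairs is half the sum over ordered pairs, the diagonal
being irrelevant since `J_{xx} = 0` for the couplings considered.) -/
noncomputable def pottsHam (d q : ℕ) (Jc : Zd d → Zd d → ℝ) (h : Zd d → ZMod q → ℝ)
    (Λ : Finset (Zd d)) (η : Zd d → ZMod q) (σ : Zd d → ZMod q) : ℝ :=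
  -(1 / 2) * (∑ x ∈ Λ, ∑ y ∈ Λ, Jc x y * (if σ x = σ y then 1 else 0))
    - ∑ x ∈ Λ, ∑' y : Zd d, (if y ∈ Λ then 0 else Jc x y * (if σ x = η y then 1 else 0))
    - ∑ x ∈ Λ, h x (σ x)

/-- Gibbs weight: the probability of the configuration `σ` under `μ^η_{Λ,β,h}`. -/
noncomputable def pottsWeight (d q : ℕ) [NeZero q] (Jc : Zd d → Zd d → ℝ) (β : ℝ)
    (h : Zd d → ZMod q → ℝ) (Λ : Finset (Zd d)) (η : Zd d → ZMod q) (σ : Λ → ZMod q) : ℝ :=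
  Real.exp (-(β * pottsHam d q Jc h Λ η (extendCfg Λ η σ)))
    / ∑ ω : Λ → ZMod q, Real.exp (-(β * pottsHam d q Jc h Λ η (extendCfg Λ η ω)))

lemma pottsWeight_sum (d q : ℕ) [NeZero q] (Jc : Zd d → Zd d → ℝ) (β : ℝ)
    (h : Zd d → ZMod q → ℝ) (Λ : Finset (Zd d)) (η : Zd d → ZMod q) :
    ∑ σ : Λ → ZMod q, pottsWeight d q Jc β h Λ η σ = 1 := by
  have hZ : 0 < ∑ ω : Λ → ZMod q,
      Real.exp (-(β * pottsHam d q Jc h Λ η (extendCfg Λ η ω))) :=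
    Finset.sum_pos (fun _ _ => Real.exp_pos _) Finset.univ_nonempty
  simp only [pottsWeight, ← Finset.sum_div]
  exact div_self hZ.ne'

/-- The finite-volume Gibbs measure `μ^η_{Λ,β,h}` of the Potts model with external
field `h` and boundary condition `η`, as a Borel probability measure on
`Ω = (ℤ^d → ZMod q)` supported on `Ω_Λ^η`. -/
noncomputable def pottsGibbsPM (d q : ℕ) [NeZero q] (Jc : Zd d → Zd d → ℝ) (β : ℝ)
    (h : Zd d → ZMod q → ℝ) (Λ : Finset (Zd d)) (η : Zd d → ZMod q) :
    ProbabilityMeasure (Zd d → ZMod q) :=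
  ⟨∑ σ : Λ → ZMod q, (ENNReal.ofReal (pottsWeight d q Jc β h Λ η σ)) •
      Measure.dirac (extendCfg Λ η σ), by
    constructor
    rw [Measure.coe_finset_sum]
    simp only [Finset.sum_apply, Measure.smul_apply, smul_eq_mul, measure_univ, mul_one]
    rw [← ENNReal.ofReal_sum_of_nonneg (fun σ _ => by unfold pottsWeight; positivity),
      pottsWeight_sum, ENNReal.ofReal_one]⟩

/-- `𝒢_{β,h}`: the set of all weak cluster points, over all boundary conditions `η`, of
the nets `Λ ↦ μ^η_{Λ,β,h}` of finite-volume Gibbs measures (indexed by the finite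
subsets of `ℤ^d` directed by inclusion). -/
def gibbsClusterSet (d q : ℕ) [NeZero q] (Jc : Zd d → Zd d → ℝ) (β : ℝ)
    (h : Zd d → ZMod q → ℝ) : Set (ProbabilityMeasure (Zd d → ZMod q)) :=
  {μ | ∃ η : Zd d → ZMod q,
    MapClusterPt μ atTop (fun Λ : Finset (Zd d) => pottsGibbsPM d q Jc β h Λ η)}

/-- Long-range couplings `J_{xy} = J / |x-y|^α` for `x ≠ y`, and `J_{xx} = 0`. -/
noncomputable def Jcoup (d : ℕ) (J α : ℝ) (x y : Zd d) : ℝ :=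
  if x = y then 0 else J / ((l1 (x - y) : ℝ) ^ α)

namespace PottsPeierls

/-! ### Geometry of the lattice -/

/-- The ℓ¹-norm on `ℤ^d` as a natural number. -/
def nm {d : ℕ} (x : Zd d) : ℕ := ∑ i, (x i).natAbs

/-- The coordinate unit vectors. -/
abbrev ee {d : ℕ} (i : Fin d) : Zd d := Pi.single i 1

/-- The cube of radius `r` around `x`. -/
def cube {d : ℕ} (r : ℕ) (x : Zd d) : Finset (Zd d) :=
  Finset.Icc (fun i => x i - r) (fun i => x i + r)

lemma l1_eq_nm {d : ℕ} (x : Zd d) : l1 x = (nm x : ℤ) := by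
  simp [l1, nm]

lemma nm_eq_zero {d : ℕ} {x : Zd d} : nm x = 0 ↔ x = 0 := by
  simp [nm, funext_iff]

@[simp] lemma nm_zero {d : ℕ} : nm (0 : Zd d) = 0 := nm_eq_zero.2 rfl

lemma nm_neg {d : ℕ} (x : Zd d) : nm (-x) = nm x := by
  simp [nm]

lemma nm_sub_comm {d : ℕ} (x y : Zd d) : nm (x - y) = nm (y - x) := by
  rw [← nm_neg, neg_sub]

lemma nm_add_le {d : ℕ} (x y : Zd d) : nm (x + y) ≤ nm x + nm y := by
  rw [nm, nm, nm, ← Finset.sum_add_distrib]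
  exact Finset.sum_le_sum fun i _ => Int.natAbs_add_le _ _

lemma nm_sub_le {d : ℕ} (x y z : Zd d) : nm (x - z) ≤ nm (x - y) + nm (y - z) := by
  simpa using nm_add_le (x - y) (y - z)

lemma natAbs_le_nm {d : ℕ} (x : Zd d) (i : Fin d) : (x i).natAbs ≤ nm x :=
  Finset.single_le_sum (f := fun i => (x i).natAbs) (fun _ _ => Nat.zero_le _) (Finset.mem_univ i)

lemma nm_single {d : ℕ} (i : Fin d) (t : ℤ) : nm (Pi.single i t : Zd d) = t.natAbs := by
  rw [nm, Finset.sum_eq_single i]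
  · simp
  · intro j _ hj
    simp [Pi.single_eq_of_ne hj]
  · simp

lemma nm_ee {d : ℕ} (i : Fin d) : nm (ee i) = 1 := by
  simp [nm_single]

lemma mem_cube {d : ℕ} {r : ℕ} {x y : Zd d} :
    y ∈ cube r x ↔ ∀ i, (y i - x i).natAbs ≤ r := by
  simp only [cube, Finset.mem_Icc, Pi.le_def, ← forall_and]
  refine forall_congr' fun i => ?_
  omega

lemma mem_cube_comm {d : ℕ} {r : ℕ} {x y : Zd d} : y ∈ cube r x ↔ x ∈ cube r y := by
  simp only [mem_cube]
  refine forall_congr' fun i => ?_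
  omega

lemma self_mem_cube {d : ℕ} (r : ℕ) (x : Zd d) : x ∈ cube r x := by
  simp [mem_cube]

lemma cube_mono {d : ℕ} {r s : ℕ} (h : r ≤ s) (x : Zd d) : cube r x ⊆ cube s x := fun _ hy =>
  mem_cube.2 fun i => (mem_cube.1 hy i).trans h

lemma mem_cube_of_nm_le {d : ℕ} {r : ℕ} {x y : Zd d} (h : nm (y - x) ≤ r) : y ∈ cube r x :=
  mem_cube.2 fun i => (natAbs_le_nm (y - x) i).trans h

lemma nm_le_of_mem_cube {d : ℕ} {r : ℕ} {x y : Zd d} (h : y ∈ cube r x) :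
    nm (y - x) ≤ d * r := by
  calc nm (y - x) ≤ ∑ _i : Fin d, r := Finset.sum_le_sum fun i _ => mem_cube.1 h i
    _ = d * r := by simp

lemma card_cube {d : ℕ} (r : ℕ) (x : Zd d) : (cube r x).card = (2 * r + 1) ^ d := by
  rw [cube, Pi.card_Icc]
  simp only [Int.card_Icc]
  rw [Finset.prod_congr rfl (fun i _ => show (x i + r + 1 - (x i - r)).toNat = 2 * r + 1 by omega)]
  simp

/-- If `f` takes different values at two points, some lattice edge with nonzero gradient has its
base point in the coordinate hull of the two points. -/
lemma exists_edge_of_ne {d : ℕ} {A : Type*} (f : Zd d → A) (y : Zd d) :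
    ∀ (n : ℕ) (x : Zd d), nm (y - x) = n → f x ≠ f y →
      ∃ z i, f (z + ee i) ≠ f z ∧ ∀ j, min (x j) (y j) ≤ z j ∧ z j ≤ max (x j) (y j) := by
  intro n
  induction n using Nat.strong_induction_on with
  | _ n ih =>
    intro x hx hne
    have hxy : ∃ i, x i ≠ y i := by
      by_contra! h
      exact hne (by rw [funext h])
    obtain ⟨i, hi⟩ := hxy
    have key : ∀ x' : Zd d, (∀ j, j ≠ i → x' j = x j) → (y i - x' i).natAbs < (y i - x i).natAbs →
        nm (y - x') < n := by
      intro x' h1 h2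
      rw [← hx]
      refine Finset.sum_lt_sum (fun j _ => ?_) ⟨i, Finset.mem_univ i, by simpa using h2⟩
      by_cases hj : j = i
      · subst hj
        simpa using h2.le
      · simp [h1 j hj]
    rcases lt_or_gt_of_ne hi with hlt | hgt
    · by_cases hf : f (x + ee i) = f x
      · have hx'j : ∀ j, j ≠ i → (x + ee i) j = x j := fun j hj => by simp [Pi.single_eq_of_ne hj]
        have hx'i : (x + ee i) i = x i + 1 := by simp
        obtain ⟨z, k, hz, hz'⟩ := ih _ (key _ hx'j (by rw [hx'i]; omega)) (x + ee i) rfl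
          (by rw [hf]; exact hne)
        refine ⟨z, k, hz, fun j => ?_⟩
        have := hz' j
        by_cases hj : j = i
        · subst hj
          rw [hx'i] at this
          omega
        · rwa [hx'j j hj] at this
      · exact ⟨x, i, hf, fun j => ⟨min_le_left _ _, le_max_left _ _⟩⟩
    · have hx'j : ∀ j, j ≠ i → (x - ee i) j = x j := fun j hj => by simp [Pi.single_eq_of_ne hj]
      have hx'i : (x - ee i) i = x i - 1 := by simp
      by_cases hf : f (x - ee i) = f x
      · obtain ⟨z, k, hz, hz'⟩ := ih _ (key _ hx'j (by rw [hx'i]; omega)) (x - ee i) rfl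
          (by rw [hf]; exact hne)
        refine ⟨z, k, hz, fun j => ?_⟩
        have := hz' j
        by_cases hj : j = i
        · subst hj
          rw [hx'i] at this
          omega
        · rwa [hx'j j hj] at this
      · refine ⟨x - ee i, i, by simpa using Ne.symm hf, fun j => ?_⟩
        by_cases hj : j = i
        · subst hj
          rw [hx'i]
          omega
        · rw [hx'j j hj]
          exact ⟨min_le_left _ _, le_max_left _ _⟩

lemma nm_sub_le_of_hull {d : ℕ} {x y z w : Zd d}
    (hz : ∀ j, min (x j) (y j) ≤ z j ∧ z j ≤ max (x j) (y j))
    (hw : ∀ j, min (x j) (y j) ≤ w j ∧ w j ≤ max (x j) (y j)) : nm (z - w) ≤ nm (x - y) := by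
  refine Finset.sum_le_sum fun j _ => ?_
  have h1 := hz j
  have h2 := hw j
  simp only [Pi.sub_apply]
  omega

/-! ### Closed gradient fields and their potentials -/

lemma sum_Ico_int_telescope {A : Type*} [AddCommGroup A] (g : ℤ → A) {a b : ℤ} (h : a ≤ b) :
    ∑ t ∈ Finset.Ico a b, (g (t + 1) - g t) = g b - g a := by
  induction b, h using Int.leInduction with
  | base => simp
  | succ b hb ih =>
    rw [← Finset.insert_Ico_right_eq_Ico_add_one hb, Finset.sum_insert (by simp), ih]
    abel

/-- A compactly supported closed gradient field on `ℤ^d`, `d ≥ 2`, is the gradient of a function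
with the same box support. -/
lemma exists_potential {d : ℕ} (hd : 2 ≤ d) {A : Type*} [AddCommGroup A] (R : ℕ)
    (c : Zd d → Fin d → A)
    (hclosed : ∀ x i j, c x i + c (x + ee i) j = c x j + c (x + ee j) i)
    (hsupp : ∀ x i, x ∉ cube R 0 → x + ee i ∉ cube R 0 → c x i = 0) :
    ∃ f : Zd d → A, (∀ x, x ∉ cube R 0 → f x = 0) ∧ ∀ x i, f (x + ee i) - f x = c x i := by
  classical
  set i0 : Fin d := ⟨0, by omega⟩
  set i1 : Fin d := ⟨1, by omega⟩
  have hi : i1 ≠ i0 := by simp [i0, i1]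
  have out : ∀ (x : Zd d) (j k : Fin d), j ≠ k → R < (x k).natAbs → c x j = 0 := by
    intro x j k hjk hk
    refine hsupp x j (fun h => ?_) fun h => ?_
    · have := mem_cube.1 h k
      simp at this
      omega
    · have := mem_cube.1 h k
      simp [Pi.single_eq_of_ne (Ne.symm hjk)] at this
      omega
  set F : Zd d → A := fun x =>
    ∑ t ∈ Finset.Ico (-(R : ℤ) - 1) (x i0), c (Function.update x i0 t) i0 with hF
  have low : ∀ (x : Zd d) (j : Fin d), x i0 < -(R : ℤ) - 1 → c x j = 0 := by
    intro x j hx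
    refine hsupp x j (fun h => ?_) fun h => ?_
    · have := mem_cube.1 h i0
      simp at this
      omega
    · have := mem_cube.1 h i0
      by_cases hj : j = i0
      · subst hj
        simp at this
        omega
      · simp [Pi.single_eq_of_ne (Ne.symm hj)] at this
        omega
  have grad : ∀ x i, F (x + ee i) - F x = c x i := by
    intro x i
    by_cases hi0 : i = i0
    · subst hi0
      have hup : ∀ t, Function.update (x + ee i0) i0 t = Function.update x i0 t := by
        intro t
        ext j
        by_cases hj : j = i0
        · subst hj; simp
        · simp [Function.update_of_ne hj, Pi.single_eq_of_ne hj]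
      simp only [hF, hup, Pi.add_apply, Pi.single_eq_same]
      rcases lt_or_ge (x i0) (-(R : ℤ) - 1) with hlt | hge
      · rw [Finset.Ico_eq_empty (by omega), Finset.Ico_eq_empty (by omega), low x i0 hlt]
        simp
      · rw [← Finset.insert_Ico_right_eq_Ico_add_one hge, Finset.sum_insert (by simp)]
        simp
    · have hup : ∀ t, Function.update (x + ee i) i0 t = Function.update x i0 t + ee i := by
        intro t
        ext j
        by_cases hj : j = i0
        · subst hj; simp [Pi.single_eq_of_ne (Ne.symm hi0)]
        · simp [Function.update_of_ne hj]
      have hup' : ∀ t, Function.update x i0 t + ee i0 = Function.update x i0 (t + 1) := by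
        intro t
        ext j
        by_cases hj : j = i0
        · subst hj; simp
        · simp [Function.update_of_ne hj, Pi.single_eq_of_ne hj]
      have hx0 : (x + ee i) i0 = x i0 := by simp [Pi.single_eq_of_ne (Ne.symm hi0)]
      simp only [hF, hup, hx0]
      rw [← Finset.sum_sub_distrib]
      have hstep : ∀ t, c (Function.update x i0 t + ee i) i0 - c (Function.update x i0 t) i0
          = c (Function.update x i0 (t + 1)) i - c (Function.update x i0 t) i := by
        intro t
        have := hclosed (Function.update x i0 t) i i0
        rw [hup'] at this
        rw [sub_eq_sub_iff_add_eq_add, add_comm, this, add_comm]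
      simp only [hstep]
      rcases lt_or_ge (x i0) (-(R : ℤ) - 1) with hlt | hge
      · rw [Finset.Ico_eq_empty (by omega), low x i hlt]
        simp
      · rw [sum_Ico_int_telescope (fun t => c (Function.update x i0 t) i) hge]
        rw [out (Function.update x i0 (-(R : ℤ) - 1)) i i0 hi0 (by simp; omega)]
        simp
  have side : ∀ (x : Zd d) (k : Fin d), k ≠ i0 → R < (x k).natAbs → F x = 0 := by
    intro x k hk hx
    refine Finset.sum_eq_zero fun t _ => out _ i0 k (Ne.symm hk) ?_
    rwa [Function.update_of_ne hk]
  refine ⟨F, fun x hx => ?_, grad⟩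
  have hex : ∃ k, R < (x k).natAbs := by
    by_contra! h
    exact hx (mem_cube.2 fun i => by simpa using h i)
  obtain ⟨k, hk⟩ := hex
  by_cases hk0 : k = i0
  · subst hk0
    rcases le_or_gt (x i0) 0 with hneg | hpos
    · simp only [hF]
      rw [Finset.Ico_eq_empty (by omega)]
      simp
    · have move : ∀ n : ℕ, F (x + Pi.single i1 (n : ℤ)) = F x := by
        intro n
        induction n with
        | zero => simp
        | succ n ih =>
          have h1 := grad (x + Pi.single i1 (n : ℤ)) i1
          have h2 : c (x + Pi.single i1 (n : ℤ)) i1 = 0 := by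
            refine out _ i1 i0 hi ?_
            simpa [Pi.single_eq_of_ne (Ne.symm hi)] using hk
          rw [h2, sub_eq_zero, ih] at h1
          rw [← h1, add_assoc, ← Pi.single_add]
          simp
      rw [← move ((x i1).natAbs + R + 1)]
      refine side _ i1 hi ?_
      simp only [Pi.add_apply, Pi.single_eq_same]
      omega
  · exact side x k hk0 hk

lemma eq_of_grad_eq {d : ℕ} {A : Type*} [AddCommGroup A] (f g : Zd d → A)
    (h : ∀ x i, f (x + ee i) - f x = g (x + ee i) - g x) (x0 : Zd d) (h0 : f x0 = g x0) :
    f = g := by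
  funext x
  by_contra hne
  have : (f - g) x ≠ (f - g) x0 := by
    simp only [Pi.sub_apply, h0, sub_self, ne_eq, sub_eq_zero]
    exact hne
  obtain ⟨z, i, hz, -⟩ := exists_edge_of_ne (f - g) x0 _ x rfl this
  apply hz
  have := h z i
  simp only [Pi.sub_apply]
  rw [sub_eq_sub_iff_add_eq_add] at this ⊢
  rw [this, add_comm]

/-! ### Hierarchically built sets and separated partitions -/

/-- Finite sets obtained from singletons by successively merging disjoint sets `A`, `B` whose
distance is at most `M * (min |A| |B|) ^ a`. -/
inductive Built {E : Type*} [DecidableEq E] (D : E → E → ℕ) (M a : ℕ) : Finset E → Prop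
  | single (e : E) : Built D M a {e}
  | merge (A B : Finset E) (p p' : E) (hA : Built D M a A) (hB : Built D M a B)
      (hAB : Disjoint A B) (hp : p ∈ A) (hp' : p' ∈ B)
      (hD : D p p' ≤ M * (min A.card B.card) ^ a) : Built D M a (A ∪ B)

lemma Built.nonempty {E : Type*} [DecidableEq E] {D : E → E → ℕ} {M a : ℕ} {A : Finset E}
    (h : Built D M a A) : A.Nonempty := by
  induction h with
  | single e => simp
  | merge A B p p' hA hB hAB hp hp' hD ihA ihB => exact ihA.mono Finset.subset_union_left

lemma Built.card_pos {E : Type*} [DecidableEq E] {D : E → E → ℕ} {M a : ℕ} {A : Finset E}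
    (h : Built D M a A) : 0 < A.card := h.nonempty.card_pos

lemma pow_succ_add_pow_succ_le (a m n : ℕ) (ha : 1 ≤ a) :
    m ^ (a + 1) + n ^ (a + 1) + (min m n) ^ a ≤ (m + n) ^ (a + 1) := by
  wlog h : m ≤ n generalizing m n
  · have := this n m (by omega)
    rwa [min_comm, add_comm n m, add_comm (n ^ (a + 1))] at this
  rw [min_eq_left h]
  have h1 : m ^ a ≤ (m + n) ^ a := Nat.pow_le_pow_left (by omega) a
  have h2 : n ^ a + m ^ a ≤ (m + n) ^ a := by
    have := pow_add_pow_le (Nat.zero_le m) (Nat.zero_le n) (by omega : a ≠ 0)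
    omega
  rcases Nat.eq_zero_or_pos n with rfl | hn
  · simp [show m = 0 by omega, show a ≠ 0 by omega]
  calc m ^ (a + 1) + n ^ (a + 1) + m ^ a
      ≤ m ^ a * m + n ^ a * n + m ^ a * n := by
        rw [pow_succ, pow_succ]
        gcongr
        exact Nat.le_mul_of_pos_right _ hn
    _ = m ^ a * m + (n ^ a + m ^ a) * n := by ring
    _ ≤ (m + n) ^ a * m + (m + n) ^ a * n := by gcongr
    _ = (m + n) ^ (a + 1) := by ring

lemma Built.diam_le {E : Type*} [DecidableEq E] {D : E → E → ℕ} {M a : ℕ} (ha : 1 ≤ a)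
    (hself : ∀ x, D x x = 0) (hsymm : ∀ x y, D x y = D y x)
    (htri : ∀ x y z, D x z ≤ D x y + D y z) {A : Finset E} (h : Built D M a A) :
    ∀ x ∈ A, ∀ y ∈ A, D x y ≤ M * A.card ^ (a + 1) := by
  induction h with
  | single e =>
    intro x hx y hy
    rw [Finset.mem_singleton.1 hx, Finset.mem_singleton.1 hy, hself]
    exact Nat.zero_le _
  | merge A B p p' hA hB hAB hp hp' hD ihA ihB =>
    rw [Finset.card_union_of_disjoint hAB]
    have key := Nat.mul_le_mul_left M (pow_succ_add_pow_succ_le a A.card B.card ha)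
    rw [Nat.mul_add, Nat.mul_add] at key
    have mixed : ∀ x ∈ A, ∀ y ∈ B, D x y ≤ M * (A.card + B.card) ^ (a + 1) := by
      intro x hx y hy
      have := htri x p y
      have := htri p p' y
      have := ihA x hx p hp
      have := ihB p' hp' y hy
      omega
    intro x hx y hy
    rcases Finset.mem_union.1 hx with hx | hx <;> rcases Finset.mem_union.1 hy with hy | hy
    · have := ihA x hx y hy
      omega
    · exact mixed x hx y hy
    · rw [hsymm]
      exact mixed y hy x hx
    · have := ihB x hx y hy
      omega

/-- Members of `P` are pairwise far apart, at the scale used to merge sets. -/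
def Separated {E : Type*} (D : E → E → ℕ) (M a : ℕ) (P : Finset (Finset E)) : Prop :=
  ∀ A ∈ P, ∀ B ∈ P, A ≠ B → ∀ p ∈ A, ∀ p' ∈ B, M * (min A.card B.card) ^ a < D p p'

lemma exists_separated_partition {E : Type*} [DecidableEq E] (D : E → E → ℕ) (M a : ℕ)
    (S : Finset E) :
    ∃ P : Finset (Finset E), (∀ A ∈ P, Built D M a A) ∧
      (∀ A ∈ P, ∀ B ∈ P, A ≠ B → Disjoint A B) ∧ (∀ e, e ∈ S ↔ ∃ A ∈ P, e ∈ A) ∧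
      Separated D M a P := by
  have main : ∀ (n : ℕ) (P : Finset (Finset E)), P.card = n → (∀ A ∈ P, Built D M a A) →
      (∀ A ∈ P, ∀ B ∈ P, A ≠ B → Disjoint A B) → (∀ e, e ∈ S ↔ ∃ A ∈ P, e ∈ A) →
      ∃ P : Finset (Finset E), (∀ A ∈ P, Built D M a A) ∧
        (∀ A ∈ P, ∀ B ∈ P, A ≠ B → Disjoint A B) ∧ (∀ e, e ∈ S ↔ ∃ A ∈ P, e ∈ A) ∧
        Separated D M a P := by
    intro n
    induction n using Nat.strong_induction_on with
    | _ n ih =>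
      intro P hn h1 h2 h3
      by_cases hsep : Separated D M a P
      · exact ⟨P, h1, h2, h3, hsep⟩
      · simp only [Separated, not_forall, not_lt] at hsep
        obtain ⟨A, hA, B, hB, hAB, p, hp, p', hp', hD⟩ := hsep
        set Q := (P.erase A).erase B with hQ
        have hcard : Q.card + 2 = P.card := by
          have hB' : B ∈ P.erase A := Finset.mem_erase.2 ⟨hAB.symm, hB⟩
          have e1 := Finset.card_erase_add_one hA
          have e2 : Q.card + 1 = _ := Finset.card_erase_add_one hB'
          omega
        have hmem : ∀ C, C ∈ Q ↔ C ≠ B ∧ C ≠ A ∧ C ∈ P := by simp [hQ]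
        have hdis : ∀ C ∈ Q, Disjoint (A ∪ B) C := by
          intro C hC
          obtain ⟨c1, c2, c3⟩ := (hmem C).1 hC
          exact Finset.disjoint_union_left.2
            ⟨h2 A hA C c3 c2.symm, h2 B hB C c3 c1.symm⟩
        refine ih (insert (A ∪ B) Q).card ?_ (insert (A ∪ B) Q) rfl ?_ ?_ ?_
        · have := Finset.card_insert_le (A ∪ B) Q
          omega
        · intro C hC
          rcases Finset.mem_insert.1 hC with rfl | hC
          · exact Built.merge A B p p' (h1 A hA) (h1 B hB) (h2 A hA B hB hAB) hp hp' hD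
          · exact h1 C ((hmem C).1 hC).2.2
        · intro C hC C' hC' hne
          rcases Finset.mem_insert.1 hC with rfl | hC <;>
            rcases Finset.mem_insert.1 hC' with rfl | hC'
          · exact absurd rfl hne
          · exact hdis C' hC'
          · exact (hdis C hC).symm
          · exact h2 C ((hmem C).1 hC).2.2 C' ((hmem C').1 hC').2.2 hne
        · intro e
          rw [h3]
          constructor
          · rintro ⟨C, hC, he⟩
            by_cases hCA : C = A
            · exact ⟨A ∪ B, by simp, by simp [← hCA, he]⟩
            by_cases hCB : C = B
            · exact ⟨A ∪ B, by simp, by simp [← hCB, he]⟩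
            · exact ⟨C, Finset.mem_insert_of_mem ((hmem C).2 ⟨hCB, hCA, hC⟩), he⟩
          · rintro ⟨C, hC, he⟩
            rcases Finset.mem_insert.1 hC with rfl | hC
            · rcases Finset.mem_union.1 he with he | he
              · exact ⟨A, hA, he⟩
              · exact ⟨B, hB, he⟩
            · exact ⟨C, ((hmem C).1 hC).2.2, he⟩
  refine main _ (S.image fun e => {e}) rfl ?_ ?_ ?_
  · intro A hA
    obtain ⟨e, -, rfl⟩ := Finset.mem_image.1 hA
    exact Built.single e
  · intro A hA B hB hne
    obtain ⟨e, -, rfl⟩ := Finset.mem_image.1 hA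
    obtain ⟨e', -, rfl⟩ := Finset.mem_image.1 hB
    simpa [eq_comm] using hne
  · intro e
    simp

/-! ### Contours -/

/-- Lattice edges labelled with a nonzero gradient value. -/
abbrev Edge (d q : ℕ) := Zd d × Fin d × ZMod q

/-- Distance between the base points of two labelled edges. -/
def edist {d q : ℕ} (p p' : Edge d q) : ℕ := nm (p.1 - p'.1)

lemma edist_self {d q : ℕ} (p : Edge d q) : edist p p = 0 := by simp [edist]

lemma edist_comm {d q : ℕ} (p p' : Edge d q) : edist p p' = edist p' p := nm_sub_comm _ _

lemma edist_triangle {d q : ℕ} (p p' p'' : Edge d q) :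
    edist p p'' ≤ edist p p' + edist p' p'' := nm_sub_le _ _ _

/-- `γ` is the set of nonzero gradients of `f`. -/
def IsGrad {d q : ℕ} (γ : Finset (Edge d q)) (f : Zd d → ZMod q) : Prop :=
  ∀ x i v, (x, i, v) ∈ γ ↔ f (x + ee i) - f x = v ∧ v ≠ 0

/-- The labelled edges with base point in a box. -/
def boxEdges (d q : ℕ) [NeZero q] (R : ℕ) : Finset (Edge d q) :=
  cube (R + 1) 0 ×ˢ Finset.univ

lemma grad_eq_zero_of_notMem {d q R : ℕ} {f : Zd d → ZMod q}
    (hf : ∀ x, x ∉ cube R 0 → f x = 0) {x : Zd d} (i : Fin d) (hx : x ∉ cube (R + 1) 0) :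
    f (x + ee i) - f x = 0 := by
  rw [hf x fun h => hx (cube_mono (by omega) _ h), hf (x + ee i), sub_zero]
  intro h
  apply hx
  rw [mem_cube] at h ⊢
  intro j
  have := h j
  by_cases hj : j = i
  · subst hj
    simp at this ⊢
    omega
  · simp [Pi.single_eq_of_ne hj] at this ⊢
    omega

lemma IsGrad.subset_boxEdges {d q R : ℕ} [NeZero q] {γ : Finset (Edge d q)} {f : Zd d → ZMod q}
    (h : IsGrad γ f) (hf : ∀ x, x ∉ cube R 0 → f x = 0) : γ ⊆ boxEdges d q R := by
  rintro ⟨x, i, v⟩ hx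
  simp only [boxEdges, Finset.mem_product, Finset.mem_univ, and_true]
  by_contra hx'
  obtain ⟨h1, h2⟩ := (h x i v).1 hx
  exact h2 (h1 ▸ grad_eq_zero_of_notMem hf i hx')

lemma exists_isGrad {d q R : ℕ} [NeZero q] {f : Zd d → ZMod q}
    (hf : ∀ x, x ∉ cube R 0 → f x = 0) : ∃ S : Finset (Edge d q), IsGrad S f := by
  classical
  refine ⟨(boxEdges d q R).filter fun p => f (p.1 + ee p.2.1) - f p.1 = p.2.2 ∧ p.2.2 ≠ 0, ?_⟩
  intro x i v
  simp only [boxEdges, Finset.mem_filter, Finset.mem_product, Finset.mem_univ, and_true,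
    and_iff_right_iff_imp]
  rintro ⟨h1, h2⟩
  by_contra hx
  exact h2 (h1 ▸ grad_eq_zero_of_notMem hf i hx)

lemma exists_notMem_cube {d : ℕ} (hd : 2 ≤ d) (R : ℕ) : ∃ x : Zd d, x ∉ cube R 0 := by
  refine ⟨fun _ => R + 1, fun h => ?_⟩
  have := mem_cube.1 h ⟨0, by omega⟩
  simp at this
  omega

lemma IsGrad.unique {d q R : ℕ} (hd : 2 ≤ d) {γ : Finset (Edge d q)}
    {f g : Zd d → ZMod q} (h : IsGrad γ f) (h' : IsGrad γ g)
    (hf : ∀ x, x ∉ cube R 0 → f x = 0) (hg : ∀ x, x ∉ cube R 0 → g x = 0) : f = g := by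
  obtain ⟨x0, hx0⟩ := exists_notMem_cube hd R
  refine eq_of_grad_eq f g (fun x i => ?_) x0 (by rw [hf x0 hx0, hg x0 hx0])
  by_cases h0 : f (x + ee i) - f x = 0
  · by_contra hne
    rw [h0] at hne
    have h1 := (h' x i _).2 ⟨rfl, Ne.symm hne⟩
    exact hne (h0.symm.trans ((h x i _).1 h1).1)
  · have h1 := (h x i _).2 ⟨rfl, h0⟩
    exact ((h' x i _).1 h1).1.symm

/-- Every compactly supported configuration is a superposition of separated contours. -/
theorem exists_contours {d q R M a : ℕ} [NeZero q] (hd : 2 ≤ d) (hM : 2 ≤ M)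
    {f : Zd d → ZMod q} (hf : ∀ x, x ∉ cube R 0 → f x = 0) :
    ∃ (P : Finset (Finset (Edge d q))) (g : Finset (Edge d q) → Zd d → ZMod q),
      (∀ γ ∈ P, Built edist M a γ ∧ IsGrad γ (g γ) ∧ ∀ x, x ∉ cube R 0 → g γ x = 0) ∧
      Separated edist M a P ∧ f = ∑ γ ∈ P, g γ := by
  classical
  obtain ⟨S, hS⟩ := exists_isGrad hf
  obtain ⟨P, hP1, hP2, hP3, hP4⟩ := exists_separated_partition (edist (d := d) (q := q)) M a S
  set G : Zd d → Fin d → ZMod q := fun x i => f (x + ee i) - f x with hG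
  set c : Finset (Edge d q) → Zd d → Fin d → ZMod q :=
    fun γ x i => if (x, i, G x i) ∈ γ then G x i else 0 with hc
  have near : ∀ γ ∈ P, ∀ x i, (x, i, G x i) ∈ γ → ∀ y j, nm (x - y) ≤ 2 → c γ y j = G y j := by
    intro γ hγ x i hx y j hxy
    simp only [hc]
    split_ifs with hy
    · rfl
    · by_contra hne
      have hyS : (y, j, G y j) ∈ S := (hS _ _ _).2 ⟨rfl, Ne.symm hne⟩
      obtain ⟨γ', hγ', hy'⟩ := (hP3 _).1 hyS
      have hne' : γ ≠ γ' := by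
        rintro rfl
        exact hy hy'
      have h1 := hP4 γ hγ γ' hγ' hne' _ hx _ hy'
      have h2 : 1 ≤ min γ.card γ'.card := le_min (hP1 γ hγ).card_pos (hP1 γ' hγ').card_pos
      have h3 : 1 ≤ (min γ.card γ'.card) ^ a := Nat.one_le_pow _ _ h2
      have h4 := Nat.mul_le_mul_left M h3
      simp only [edist] at h1
      omega
  have hzero : ∀ γ x i, (x, i, G x i) ∉ γ → c γ x i = 0 := fun γ x i h => if_neg h
  have hclosed : ∀ γ ∈ P, ∀ x i j, c γ x i + c γ (x + ee i) j = c γ x j + c γ (x + ee j) i := by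
    intro γ hγ x i j
    have hGc : G x i + G (x + ee i) j = G x j + G (x + ee j) i := by
      simp only [hG]
      rw [add_right_comm x (ee j)]
      abel
    have n1 : nm (-ee i : Zd d) ≤ 2 := by rw [nm_neg, nm_ee]; omega
    have n2 : nm (-ee j : Zd d) ≤ 2 := by rw [nm_neg, nm_ee]; omega
    have n1' : nm (ee i : Zd d) ≤ 2 := by rw [nm_ee]; omega
    have n2' : nm (ee j : Zd d) ≤ 2 := by rw [nm_ee]; omega
    have n3 : nm (ee i - ee j : Zd d) ≤ 2 := by
      rw [sub_eq_add_neg]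
      refine (nm_add_le _ _).trans ?_
      rw [nm_neg, nm_ee, nm_ee]
    have n4 : nm (ee j - ee i : Zd d) ≤ 2 := by rwa [nm_sub_comm]
    have good : ∀ z k, (z, k, G z k) ∈ γ → nm (z - x) ≤ 2 → nm (z - (x + ee i)) ≤ 2 →
        nm (z - (x + ee j)) ≤ 2 → c γ x i + c γ (x + ee i) j = c γ x j + c γ (x + ee j) i := by
      intro z k hz h1 h2 h3
      have := near γ hγ z k hz
      rw [this x i h1, this x j h1, this (x + ee i) j h2, this (x + ee j) i h3, hGc]
    by_cases h1 : (x, i, G x i) ∈ γ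
    · exact good x i h1 (by simp) (by simpa using n1) (by simpa using n2)
    by_cases h2 : (x, j, G x j) ∈ γ
    · exact good x j h2 (by simp) (by simpa using n1) (by simpa using n2)
    by_cases h3 : (x + ee i, j, G (x + ee i) j) ∈ γ
    · exact good _ j h3 (by simpa using n1') (by simp) (by simpa using n3)
    by_cases h4 : (x + ee j, i, G (x + ee j) i) ∈ γ
    · exact good _ i h4 (by simpa using n2') (by simpa using n4) (by simp)
    · rw [hzero _ _ _ h1, hzero _ _ _ h2, hzero _ _ _ h3, hzero _ _ _ h4]
  have hsupp : ∀ γ x i, x ∉ cube R 0 → x + ee i ∉ cube R 0 → c γ x i = 0 := by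
    intro γ x i h1 h2
    simp only [hc, hG, hf _ h1, hf _ h2, sub_zero, ite_self]
  have hpot : ∀ γ, ∃ g : Zd d → ZMod q, γ ∈ P →
      (∀ x, x ∉ cube R 0 → g x = 0) ∧ ∀ x i, g (x + ee i) - g x = c γ x i := by
    intro γ
    by_cases hγ : γ ∈ P
    · obtain ⟨g, hg⟩ := exists_potential hd R (c γ) (hclosed γ hγ) (hsupp γ)
      exact ⟨g, fun _ => hg⟩
    · exact ⟨0, fun h => absurd h hγ⟩
  choose g hg using hpot
  refine ⟨P, g, fun γ hγ => ⟨hP1 γ hγ, fun x i v => ?_, (hg γ hγ).1⟩, hP4, ?_⟩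
  · rw [(hg γ hγ).2]
    constructor
    · intro hx
      obtain ⟨h1, h2⟩ := (hS x i v).1 ((hP3 _).2 ⟨γ, hγ, hx⟩)
      subst h1
      exact ⟨if_pos hx, h2⟩
    · rintro ⟨h1, h2⟩
      simp only [hc] at h1
      split_ifs at h1 with hx
      · rwa [h1] at hx
      · exact absurd h1.symm h2
  · obtain ⟨x0, hx0⟩ := exists_notMem_cube hd R
    refine eq_of_grad_eq _ _ (fun x i => ?_) x0 ?_
    · rw [Finset.sum_apply, Finset.sum_apply, ← Finset.sum_sub_distrib,
        Finset.sum_congr rfl fun γ hγ => (hg γ hγ).2 x i]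
      change G x i = _
      by_cases h0 : G x i = 0
      · rw [h0]
        refine (Finset.sum_eq_zero fun γ _ => ?_).symm
        simp [hc, h0]
      · obtain ⟨γ, hγ, hx⟩ := (hP3 _).1 ((hS x i _).2 ⟨rfl, h0⟩)
        rw [Finset.sum_eq_single_of_mem γ hγ]
        · exact (if_pos hx).symm
        · intro γ' hγ' hne
          exact if_neg fun h => Finset.disjoint_left.1 (hP2 γ' hγ' γ hγ hne) h hx
    · rw [hf x0 hx0, Finset.sum_apply]
      exact (Finset.sum_eq_zero fun γ hγ => (hg γ hγ).1 x0 hx0).symm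

/-! ### Counting built sets by weighted closed walks -/

/-- Weight of the walk that starts at the given point and visits the list in order. -/
def chainW {E : Type*} (w : E → E → ℝ) : E → List E → ℝ
  | _, [] => 1
  | e, b :: l => w e b * chainW w b l

/-- End point of the walk that starts at the given point and visits the list in order. -/
def endPt {E : Type*} : E → List E → E
  | e, [] => e
  | _, b :: l => endPt b l

lemma chainW_append {E : Type*} (w : E → E → ℝ) (e : E) (l l' : List E) :
    chainW w e (l ++ l') = chainW w e l * chainW w (endPt e l) l' := by
  induction l generalizing e with
  | nil => simp [chainW, endPt]
  | cons b l ih => simp [chainW, endPt, ih, mul_assoc]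

lemma endPt_append {E : Type*} (e : E) (l l' : List E) :
    endPt e (l ++ l') = endPt (endPt e l) l' := by
  induction l generalizing e with
  | nil => simp [endPt]
  | cons b l ih => simp [endPt, ih]

lemma endPt_mem {E : Type*} (e : E) (l : List E) : endPt e l = e ∨ endPt e l ∈ l := by
  induction l generalizing e with
  | nil => simp [endPt]
  | cons b l ih =>
    right
    rcases ih b with h | h
    · simp [endPt, h]
    · simp [endPt, h]

lemma chainW_nonneg {E : Type*} {w : E → E → ℝ} (hw : ∀ e e', 0 ≤ w e e') (e : E) (l : List E) :
    0 ≤ chainW w e l := by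
  induction l generalizing e with
  | nil => simp [chainW]
  | cons b l ih => exact mul_nonneg (hw _ _) (ih b)

/-- A closed walk can be started at any point it visits. -/
lemma exists_rotate_loop {E : Type*} [DecidableEq E] (w : E → E → ℝ) {p e : E} {l : List E}
    (hl : endPt p l = p) (he : e ∈ insert p l.toFinset) :
    ∃ l' : List E, l'.length = l.length ∧ insert e l'.toFinset = insert p l.toFinset ∧
      endPt e l' = e ∧ chainW w e l' = chainW w p l := by
  rcases Finset.mem_insert.1 he with rfl | he
  · exact ⟨l, rfl, rfl, hl, rfl⟩
  obtain ⟨l1, l2, rfl⟩ := List.append_of_mem (List.mem_toFinset.1 he)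
  have hend : endPt e l2 = p := by simpa [endPt_append, endPt] using hl
  refine ⟨l2 ++ (l1 ++ [e]), by simp; omega, ?_, ?_, ?_⟩
  · have hp : p = e ∨ p ∈ l2 := hend ▸ endPt_mem e l2
    ext x
    simp only [List.toFinset_append, List.toFinset_cons, List.toFinset_nil, Finset.mem_insert,
      Finset.mem_union, List.mem_toFinset, insert_empty_eq, Finset.mem_singleton]
    constructor
    · tauto
    · rintro (rfl | h)
      · tauto
      · tauto
  · simp [endPt_append, endPt]
  · simp only [chainW_append, hend, chainW]
    ring

/-- A built set is visited by a short closed walk of large weight. -/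
lemma Built.exists_loop {E : Type*} [DecidableEq E] {D : E → E → ℕ} {M a : ℕ}
    {w : E → E → ℝ} (hw : ∀ e e', 0 ≤ w e e') {c : ℝ} (hc : 0 < c) {b : ℕ}
    (hwD : ∀ p p' n, 1 ≤ n → D p p' ≤ M * n ^ a → (c * (n : ℝ) ^ b)⁻¹ ≤ w p p' * w p' p)
    {A : Finset E} (h : Built D M a A) :
    ∀ e ∈ A, ∃ l : List E, l.length = 2 * (A.card - 1) ∧ insert e l.toFinset = A ∧
      endPt e l = e ∧
      (2 ^ b * c) * (A.card : ℝ) ^ b * ((2 ^ b * c)⁻¹) ^ A.card ≤ chainW w e l := by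
  have hK : (0 : ℝ) < 2 ^ b * c := by positivity
  induction h with
  | single e =>
    intro e' he'
    obtain rfl := Finset.mem_singleton.1 he'
    refine ⟨[], by simp, by simp, rfl, ?_⟩
    simp only [chainW, Finset.card_singleton, Nat.cast_one, one_pow, mul_one, pow_one]
    rw [mul_inv_cancel₀ hK.ne']
  | merge A B p p' hA hB hAB hp hp' hD ihA ihB =>
    intro e he
    obtain ⟨lA, hA1, hA2, hA3, hA4⟩ := ihA p hp
    obtain ⟨lB, hB1, hB2, hB3, hB4⟩ := ihB p' hp'
    have hAc := hA.card_pos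
    have hBc := hB.card_pos
    set l : List E := p' :: (lB ++ p :: lA) with hl
    have hend : endPt p l = p := by simp [hl, endPt, endPt_append, hA3]
    have hset : insert p l.toFinset = A ∪ B := by
      rw [← hA2, ← hB2]
      ext x
      simp only [hl, List.toFinset_append, List.toFinset_cons, Finset.mem_insert,
        Finset.mem_union, List.mem_toFinset]
      tauto
    have hW : chainW w p l = (w p p' * w p' p) * (chainW w p' lB * chainW w p lA) := by
      simp only [hl, chainW, chainW_append, hB3]
      ring
    obtain ⟨l', h1, h2, h3, h4⟩ := exists_rotate_loop w hend (hset ▸ he)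
    refine ⟨l', ?_, h2.trans hset, h3, ?_⟩
    · rw [h1, Finset.card_union_of_disjoint hAB]
      simp only [hl, List.length_cons, List.length_append]
      omega
    · rw [h4, hW, Finset.card_union_of_disjoint hAB]
      set m := A.card
      set n := B.card
      set K := 2 ^ b * c with hKdef
      have hmin : 1 ≤ min m n := le_min hAc hBc
      have hstep := hwD p p' (min m n) hmin hD
      have hθ : 0 < K⁻¹ := inv_pos.2 hK
      have hmin' : (0 : ℝ) < ((min m n : ℕ) : ℝ) := by exact_mod_cast hmin
      have hmul : (m : ℝ) * n = (min m n : ℕ) * (max m n : ℕ) := by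
        exact_mod_cast (min_mul_max m n).symm
      have hmax : ((m + n : ℕ) : ℝ) ≤ 2 * (max m n : ℕ) := by
        exact_mod_cast (by omega : m + n ≤ 2 * max m n)
      calc K * ((m + n : ℕ) : ℝ) ^ b * K⁻¹ ^ (m + n)
          ≤ K * (2 * (max m n : ℕ)) ^ b * K⁻¹ ^ (m + n) := by gcongr
        _ = (c * ((min m n : ℕ) : ℝ) ^ b)⁻¹ *
            ((K * (n : ℝ) ^ b * K⁻¹ ^ n) * (K * (m : ℝ) ^ b * K⁻¹ ^ m)) := by
          have : (K * (n : ℝ) ^ b * K⁻¹ ^ n) * (K * (m : ℝ) ^ b * K⁻¹ ^ m)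
              = K * K * ((m : ℝ) * n) ^ b * K⁻¹ ^ (m + n) := by
            rw [mul_pow, pow_add]
            ring
          rw [this, hmul, mul_pow, mul_pow]
          rw [eq_inv_mul_iff_mul_eq₀ (by positivity)]
          rw [hKdef]
          ring
        _ ≤ (w p p' * w p' p) * (chainW w p' lB * chainW w p lA) := by
          gcongr
          · exact mul_nonneg (hw _ _) (hw _ _)
          · exact chainW_nonneg hw _ _

/-- All lists of a given length with entries in `U`. -/
def listsOf {E : Type*} [DecidableEq E] (U : Finset E) : ℕ → Finset (List E)
  | 0 => {[]}
  | k + 1 => (U ×ˢ listsOf U k).image fun p => p.1 :: p.2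

lemma mem_listsOf {E : Type*} [DecidableEq E] {U : Finset E} {l : List E}
    (hl : ∀ e ∈ l, e ∈ U) : l ∈ listsOf U l.length := by
  induction l with
  | nil => simp [listsOf]
  | cons b l ih =>
    refine Finset.mem_image.2 ⟨(b, l), Finset.mem_product.2 ⟨hl b (by simp), ih ?_⟩, rfl⟩
    intro e he
    exact hl e (by simp [he])

lemma sum_chainW_le {E : Type*} [DecidableEq E] {U : Finset E} {w : E → E → ℝ}
    (hw : ∀ e e', 0 ≤ w e e') {Z : ℝ} (hZ : ∀ e, ∑ e' ∈ U, w e e' ≤ Z) (hZ0 : 0 ≤ Z)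
    (k : ℕ) (e : E) :
    ∑ l ∈ listsOf U k, chainW w e l ≤ Z ^ k := by
  induction k generalizing e with
  | zero => simp [listsOf, chainW]
  | succ k ih =>
    rw [listsOf, Finset.sum_image (by
      rintro ⟨a, l⟩ _ ⟨b, l'⟩ _ h
      simpa using h), Finset.sum_product]
    calc ∑ b ∈ U, ∑ l ∈ listsOf U k, chainW w e (b :: l)
        = ∑ b ∈ U, w e b * ∑ l ∈ listsOf U k, chainW w b l := by
          refine Finset.sum_congr rfl fun b _ => ?_
          rw [Finset.mul_sum]
          rfl
      _ ≤ ∑ b ∈ U, w e b * Z ^ k := by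
          gcongr with b _
          · exact hw _ _
          · exact ih b
      _ = (∑ b ∈ U, w e b) * Z ^ k := by rw [Finset.sum_mul]
      _ ≤ Z * Z ^ k := by gcongr; exact hZ e
      _ = Z ^ (k + 1) := by ring

/-- Exponential bound on the number of built sets of a given cardinality through a point. -/
theorem card_built_le {E : Type*} [DecidableEq E] {D : E → E → ℕ} {M a : ℕ}
    {w : E → E → ℝ} (hw : ∀ e e', 0 ≤ w e e') {c : ℝ} (hc : 1 ≤ c) {b : ℕ}
    (hwD : ∀ p p' n, 1 ≤ n → D p p' ≤ M * n ^ a → (c * (n : ℝ) ^ b)⁻¹ ≤ w p p' * w p' p)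
    {U : Finset E} {Z : ℝ} (hZ : ∀ e, ∑ e' ∈ U, w e e' ≤ Z) (hZ1 : 1 ≤ Z)
    (e : E) (m : ℕ) (F : Finset (Finset E))
    (hF : ∀ A ∈ F, Built D M a A ∧ e ∈ A ∧ A ⊆ U ∧ A.card = m) :
    (F.card : ℝ) ≤ (2 ^ b * c * Z ^ 2) ^ m := by
  have hc0 : 0 < c := by linarith
  set K : ℝ := 2 ^ b * c with hKdef
  have hK : 1 ≤ K := by
    have : (1 : ℝ) ≤ 2 ^ b := one_le_pow₀ (by norm_num)
    nlinarith
  have hK0 : 0 < K := by linarith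
  have hex : ∀ A : Finset E, ∃ l : List E, A ∈ F → l ∈ listsOf U (2 * (m - 1)) ∧
      insert e l.toFinset = A ∧ K⁻¹ ^ m ≤ chainW w e l := by
    intro A
    by_cases hA : A ∈ F
    · obtain ⟨h1, h2, h3, h4⟩ := hF A hA
      obtain ⟨l, l1, l2, -, l4⟩ := h1.exists_loop hw hc0 hwD e h2
      refine ⟨l, fun _ => ⟨?_, l2, ?_⟩⟩
      · rw [← h4, ← l1]
        refine mem_listsOf fun x hx => h3 ?_
        rw [← l2]
        simp [hx]
      · refine le_trans ?_ l4
        rw [h4]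
        have hm : (1 : ℝ) ≤ (m : ℝ) ^ b := by
          refine one_le_pow₀ ?_
          rw [← h4]
          exact_mod_cast h1.card_pos
        have hθ : 0 < K⁻¹ ^ m := by positivity
        exact le_mul_of_one_le_left hθ.le (one_le_mul_of_one_le_of_one_le hK hm)
    · exact ⟨[], fun h => absurd h hA⟩
  choose L hL using hex
  have hinj : Set.InjOn L F := by
    intro A hA B hB h
    rw [← (hL A hA).2.1, ← (hL B hB).2.1, h]
  have h1 : (F.card : ℝ) * K⁻¹ ^ m ≤ Z ^ (2 * (m - 1)) := by
    calc (F.card : ℝ) * K⁻¹ ^ m = ∑ _A ∈ F, K⁻¹ ^ m := by simp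
      _ ≤ ∑ A ∈ F, chainW w e (L A) := Finset.sum_le_sum fun A hA => (hL A hA).2.2
      _ = ∑ l ∈ F.image L, chainW w e l := (Finset.sum_image hinj).symm
      _ ≤ ∑ l ∈ listsOf U (2 * (m - 1)), chainW w e l := by
          refine Finset.sum_le_sum_of_subset_of_nonneg ?_ fun l _ _ => chainW_nonneg hw e l
          intro l hl
          obtain ⟨A, hA, rfl⟩ := Finset.mem_image.1 hl
          exact (hL A hA).1
      _ ≤ Z ^ (2 * (m - 1)) := sum_chainW_le hw hZ (by linarith) _ _
  have h2 : Z ^ (2 * (m - 1)) ≤ Z ^ (2 * m) := pow_le_pow_right₀ hZ1 (by omega)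
  have h3 : (F.card : ℝ) = (F.card : ℝ) * K⁻¹ ^ m * K ^ m := by
    rw [mul_assoc, ← mul_pow, inv_mul_cancel₀ hK0.ne', one_pow, mul_one]
  calc (F.card : ℝ) = (F.card : ℝ) * K⁻¹ ^ m * K ^ m := h3
    _ ≤ Z ^ (2 * m) * K ^ m := by
        gcongr
        exact h1.trans h2
    _ = (K * Z ^ 2) ^ m := by
        rw [mul_pow K, mul_comm, pow_mul]

/-! ### Summability of the couplings -/

lemma summable_int_rpow {p : ℝ} (hp : 1 < p) :
    Summable fun n : ℤ => (1 + (n.natAbs : ℝ)) ^ (-p) := by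
  have h1 : Summable fun n : ℤ => |(n : ℝ)| ^ (-p) := Real.summable_abs_int_rpow hp
  have h2 : Summable fun n : ℤ => if n = 0 then (1 : ℝ) else 0 :=
    summable_of_ne_finset_zero (s := {0}) (by simp +contextual)
  refine Summable.of_nonneg_of_le (fun n => by positivity) (fun n => ?_) (h1.add h2)
  by_cases hn : n = 0
  · subst hn
    simp [Real.zero_rpow (by linarith : -p ≠ 0)]
  · simp only [hn, if_false, add_zero]
    have h3 : (0 : ℝ) < |(n : ℝ)| := by positivity
    refine Real.rpow_le_rpow_of_nonpos h3 ?_ (by linarith)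
    rw [Nat.cast_natAbs, Int.cast_abs]
    linarith

lemma summable_nm_rpow {d : ℕ} {s : ℝ} (hs : (d : ℝ) < s) :
    Summable fun z : Zd d => (1 + (nm z : ℝ)) ^ (-s) := by
  rcases Nat.eq_zero_or_pos d with rfl | hd
  · exact Summable.of_finite
  have hd' : (0 : ℝ) < d := by exact_mod_cast hd
  set p := s / d with hp
  have hp1 : 1 < p := by rw [hp, one_lt_div hd']; exact hs
  have hsum := summable_int_rpow hp1
  have hpt : ∀ z : Zd d, (1 + (nm z : ℝ)) ^ (-s) ≤
      ∏ i, (1 + ((z i).natAbs : ℝ)) ^ (-p) := by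
    intro z
    have h0 : (0 : ℝ) < 1 + nm z := by positivity
    calc (1 + (nm z : ℝ)) ^ (-s) = ∏ _i : Fin d, (1 + (nm z : ℝ)) ^ (-p) := by
          rw [Finset.prod_const, Finset.card_univ, Fintype.card_fin, ← Real.rpow_natCast,
            ← Real.rpow_mul h0.le, hp]
          congr 1
          field_simp
      _ ≤ _ := by
          refine Finset.prod_le_prod (fun i _ => by positivity) fun i _ => ?_
          refine Real.rpow_le_rpow_of_nonpos (by positivity) ?_ (by linarith)
          have := natAbs_le_nm z i
          have : ((z i).natAbs : ℝ) ≤ nm z := by exact_mod_cast this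
          linarith
  refine Summable.of_nonneg_of_le (fun z => by positivity) hpt ?_
  refine summable_of_sum_le (c := (∑' n : ℤ, (1 + (n.natAbs : ℝ)) ^ (-p)) ^ d)
    (fun z => Finset.prod_nonneg fun i _ => by positivity) fun u => ?_
  classical
  calc ∑ z ∈ u, ∏ i, (1 + ((z i).natAbs : ℝ)) ^ (-p)
      ≤ ∑ z ∈ Fintype.piFinset (fun i => u.image fun z => z i),
          ∏ i, (1 + ((z i).natAbs : ℝ)) ^ (-p) := by
        refine Finset.sum_le_sum_of_subset_of_nonneg ?_
          fun z _ _ => Finset.prod_nonneg fun i _ => by positivity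
        intro z hz
        rw [Fintype.mem_piFinset]
        exact fun i => Finset.mem_image_of_mem _ hz
    _ = ∏ i : Fin d, ∑ n ∈ u.image (fun z => z i), (1 + (n.natAbs : ℝ)) ^ (-p) :=
        (Finset.prod_univ_sum (fun i => u.image fun z => z i)
          fun _ n => (1 + (n.natAbs : ℝ)) ^ (-p)).symm
    _ ≤ ∏ _i : Fin d, ∑' n : ℤ, (1 + (n.natAbs : ℝ)) ^ (-p) := by
        refine Finset.prod_le_prod (fun i _ => Finset.sum_nonneg fun n _ => by positivity)
          fun i _ => hsum.sum_le_tsum _ fun n _ => by positivity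
    _ = _ := by simp

lemma rpow_neg_le_one_add {n p : ℝ} (hn : 1 ≤ n) (hp : 0 ≤ p) :
    n ^ (-p) ≤ 2 ^ p * (1 + n) ^ (-p) := by
  have h1 : (0 : ℝ) < n := by linarith
  have h2 : 2 ^ p * (1 + n) ^ (-p) = ((1 + n) / 2) ^ (-p) := by
    rw [Real.div_rpow (by linarith) (by norm_num), Real.rpow_neg (by norm_num : (0 : ℝ) ≤ 2)]
    field_simp
  rw [h2]
  exact Real.rpow_le_rpow_of_nonpos (by linarith) (by linarith) (by linarith)

/-! ### The couplings -/

lemma Jcoup_eq {d : ℕ} (J α : ℝ) (x y : Zd d) :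
    Jcoup d J α x y = if x = y then 0 else J / ((nm (x - y) : ℝ) ^ α) := by
  simp only [Jcoup, l1_eq_nm, Int.cast_natCast]

lemma Jcoup_nonneg {d : ℕ} {J : ℝ} (hJ : 0 ≤ J) (α : ℝ) (x y : Zd d) : 0 ≤ Jcoup d J α x y := by
  rw [Jcoup_eq]
  split_ifs
  · exact le_rfl
  · positivity

lemma Jcoup_symm {d : ℕ} (J α : ℝ) (x y : Zd d) : Jcoup d J α x y = Jcoup d J α y x := by
  rw [Jcoup_eq, Jcoup_eq, nm_sub_comm]
  simp only [eq_comm]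

lemma one_le_nm {d : ℕ} {x y : Zd d} (h : x ≠ y) : 1 ≤ nm (x - y) := by
  rw [Nat.one_le_iff_ne_zero, Ne, nm_eq_zero, sub_eq_zero]
  exact h

lemma Jcoup_ee {d : ℕ} (J α : ℝ) (x : Zd d) (i : Fin d) : Jcoup d J α x (x + ee i) = J := by
  have h : nm (x - (x + ee i)) = 1 := by
    rw [nm_sub_comm]
    simp [nm_ee]
  have hne : x ≠ x + ee i := by
    intro h'
    rw [← h'] at h
    simp at h
  rw [Jcoup_eq, if_neg hne, h]
  simp

lemma Jcoup_le_mul {d : ℕ} {J α : ℝ} (hJ : 0 ≤ J) (hα : 0 ≤ α) {x x' y : Zd d}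
    (hne : x' ≠ y) (h : nm (x' - y) ≤ 2 * nm (x - y)) :
    Jcoup d J α x y ≤ 2 ^ α * Jcoup d J α x' y := by
  by_cases hxy : x = y
  · rw [Jcoup_eq, if_pos hxy]
    exact mul_nonneg (by positivity) (Jcoup_nonneg hJ _ _ _)
  · rw [Jcoup_eq, Jcoup_eq, if_neg hxy, if_neg hne]
    have h1 : (0 : ℝ) < nm (x - y) := by exact_mod_cast one_le_nm hxy
    have h2 : (0 : ℝ) < nm (x' - y) := by exact_mod_cast one_le_nm hne
    have h3 : (nm (x' - y) : ℝ) ^ α ≤ 2 ^ α * (nm (x - y) : ℝ) ^ α := by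
      rw [← Real.mul_rpow (by norm_num) h1.le]
      refine Real.rpow_le_rpow h2.le ?_ hα
      exact_mod_cast h
    rw [mul_div_assoc', div_le_div_iff₀ (by positivity) (by positivity)]
    nlinarith

lemma Jcoup_le_rpow {d : ℕ} {J α : ℝ} (hJ : 0 ≤ J) (hα : 0 ≤ α) (x y : Zd d) :
    Jcoup d J α x y ≤ J * 2 ^ α * (1 + (nm (x - y) : ℝ)) ^ (-α) := by
  by_cases hxy : x = y
  · rw [Jcoup_eq, if_pos hxy]
    positivity
  · rw [Jcoup_eq, if_neg hxy]
    have h1 : (1 : ℝ) ≤ nm (x - y) := by exact_mod_cast one_le_nm hxy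
    rw [div_eq_mul_inv, ← Real.rpow_neg (by linarith), mul_assoc]
    exact mul_le_mul_of_nonneg_left (rpow_neg_le_one_add h1 hα) hJ

lemma summable_Jcoup {d : ℕ} {J α : ℝ} (hJ : 0 ≤ J) (hα : (d : ℝ) < α) (x : Zd d) :
    Summable fun y => Jcoup d J α x y := by
  have hα0 : 0 ≤ α := (Nat.cast_nonneg d).trans hα.le
  refine Summable.of_nonneg_of_le (Jcoup_nonneg hJ α x) (Jcoup_le_rpow hJ hα0 x) ?_
  exact ((Equiv.subLeft x).summable_iff.2 (summable_nm_rpow hα)).mul_left _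

/-- The couplings as extended nonnegative reals. -/
def jw (d : ℕ) (J α : ℝ) (x y : Zd d) : ENNReal := ENNReal.ofReal (Jcoup d J α x y)

lemma jw_symm {d : ℕ} (J α : ℝ) (x y : Zd d) : jw d J α x y = jw d J α y x := by
  rw [jw, Jcoup_symm, jw]

lemma tsum_jw_lt_top {d : ℕ} {J α : ℝ} (hJ : 0 ≤ J) (hα : (d : ℝ) < α) (x : Zd d) :
    ∑' y, jw d J α x y < ⊤ := by
  simp only [jw]
  rw [← ENNReal.ofReal_tsum_of_nonneg (Jcoup_nonneg hJ α x) (summable_Jcoup hJ hα x)]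
  exact ENNReal.ofReal_lt_top

lemma exists_tail_bound {d : ℕ} {J α : ℝ} (hJ : 0 ≤ J) (hα : (d : ℝ) < α) :
    ∃ C : ℝ, 0 ≤ C ∧ ∀ (R : ℕ), 1 ≤ R → ∀ x : Zd d,
      ∑' y, (if R < nm (x - y) then jw d J α x y else 0) ≤
        ENNReal.ofReal (C * (R : ℝ) ^ (-((α - d) / 2))) := by
  set s := (α - d) / 2 with hs
  have hs0 : 0 < s := by rw [hs]; linarith
  set p := α - s with hp
  have hpd : (d : ℝ) < p := by rw [hp, hs]; linarith
  have hp0 : 0 ≤ p := (Nat.cast_nonneg d).trans hpd.le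
  have hsum := summable_nm_rpow hpd
  refine ⟨J * 2 ^ p * ∑' z : Zd d, (1 + (nm z : ℝ)) ^ (-p), ?_, ?_⟩
  · have : 0 ≤ ∑' z : Zd d, (1 + (nm z : ℝ)) ^ (-p) := tsum_nonneg fun z => by positivity
    positivity
  intro R hR x
  have hR' : (1 : ℝ) ≤ R := by exact_mod_cast hR
  have hpt : ∀ y, (if R < nm (x - y) then jw d J α x y else 0) ≤
      ENNReal.ofReal (J * 2 ^ p * (1 + (nm (x - y) : ℝ)) ^ (-p) * (R : ℝ) ^ (-s)) := by
    intro y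
    split_ifs with h
    · refine ENNReal.ofReal_le_ofReal ?_
      have hne : x ≠ y := by
        rintro rfl
        simp at h
      have h1 : (R : ℝ) ≤ nm (x - y) := by exact_mod_cast h.le
      have h2 : (0 : ℝ) < nm (x - y) := by linarith
      rw [Jcoup_eq, if_neg hne, div_eq_mul_inv, ← Real.rpow_neg h2.le,
        show -α = -p + -s by rw [hp]; ring, Real.rpow_add h2, mul_assoc J, mul_assoc J]
      refine mul_le_mul_of_nonneg_left ?_ hJ
      exact mul_le_mul (rpow_neg_le_one_add (by linarith) hp0)
        (Real.rpow_le_rpow_of_nonpos (by linarith) h1 (by linarith)) (by positivity)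
        (by positivity)
    · exact zero_le
  refine (ENNReal.tsum_le_tsum hpt).trans ?_
  have hsum' : Summable fun y => J * 2 ^ p * (1 + (nm (x - y) : ℝ)) ^ (-p) * (R : ℝ) ^ (-s) :=
    (((Equiv.subLeft x).summable_iff.2 hsum).mul_left (J * 2 ^ p)).mul_right ((R : ℝ) ^ (-s))
  rw [← ENNReal.ofReal_tsum_of_nonneg (fun y => by positivity) hsum', tsum_mul_right,
    tsum_mul_left]
  have := (Equiv.subLeft x).tsum_eq fun z : Zd d => (1 + (nm z : ℝ)) ^ (-p)
  simp only [Equiv.subLeft_apply] at this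
  rw [this]

/-! ### Supports of contours -/

lemma IsGrad.exists_near {d q R : ℕ} (hd : 2 ≤ d) {γ : Finset (Edge d q)}
    {f : Zd d → ZMod q} (h : IsGrad γ f) (hf : ∀ x, x ∉ cube R 0 → f x = 0) {x : Zd d}
    (hx : f x ≠ 0) : ∃ p ∈ γ, p.1 ∈ cube γ.card x := by
  by_contra! hcon
  set m := γ.card with hm
  set i0 : Fin d := ⟨0, by omega⟩
  set i1 : Fin d := ⟨1, by omega⟩
  have hi : i1 ≠ i0 := by simp [i0, i1]
  have hconst : ∀ y ∈ cube m x, f y = f x := by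
    intro y hy
    by_contra hne
    obtain ⟨z, i, hz, hz'⟩ := exists_edge_of_ne f y _ x rfl (Ne.symm hne)
    refine hcon (z, i, f (z + ee i) - f z) ((h _ _ _).2 ⟨rfl, sub_ne_zero.2 hz⟩) ?_
    refine mem_cube.2 fun j => ?_
    have h1 := hz' j
    have h2 := mem_cube.1 hy j
    simp only
    omega
  have hline : ∀ k : Fin (m + 1), ∃ p ∈ γ, p.1 i1 = x i1 + (k : ℕ) := by
    intro k
    set y : Zd d := x + Pi.single i1 ((k : ℕ) : ℤ) with hy
    have hyc : y ∈ cube m x := by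
      refine mem_cube.2 fun j => ?_
      by_cases hj : j = i1
      · subst hj
        simp [hy]
        omega
      · simp [hy, Pi.single_eq_of_ne hj]
    set y' : Zd d := y + Pi.single i0 (((y i0).natAbs + R + 1 : ℕ) : ℤ) with hy'
    have hy0 : f y' = 0 := by
      refine hf _ fun hmem => ?_
      have h1 : (y' i0 - 0).natAbs ≤ R := mem_cube.1 hmem i0
      have h2 : y' i0 = y i0 + (((y i0).natAbs + R + 1 : ℕ) : ℤ) := by simp [hy']
      omega
    have hne : f y ≠ f y' := by
      rw [hconst y hyc, hy0]
      exact hx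
    obtain ⟨z, i, hz, hz'⟩ := exists_edge_of_ne f y' _ y rfl hne
    refine ⟨(z, i, f (z + ee i) - f z), (h _ _ _).2 ⟨rfl, sub_ne_zero.2 hz⟩, ?_⟩
    have h1 := hz' i1
    have h2 : y' i1 = y i1 := by simp [hy', Pi.single_eq_of_ne hi]
    have h3 : y i1 = x i1 + (k : ℕ) := by simp [hy]
    simp only
    omega
  choose P hP hP' using hline
  have hinj : Function.Injective P := by
    intro k l hkl
    have h1 := hP' k
    have h2 := hP' l
    rw [hkl] at h1
    ext
    omega
  have : (Finset.univ.image P).card ≤ m := Finset.card_le_card (by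
    intro p hp
    obtain ⟨k, -, rfl⟩ := Finset.mem_image.1 hp
    exact hP k)
  rw [Finset.card_image_of_injective _ hinj, Finset.card_univ, Fintype.card_fin] at this
  omega

lemma IsGrad.card_support_le {d q R : ℕ} (hd : 2 ≤ d) {γ : Finset (Edge d q)}
    {f : Zd d → ZMod q} (h : IsGrad γ f) (hf : ∀ x, x ∉ cube R 0 → f x = 0)
    {V : Finset (Zd d)} (hV : ∀ x ∈ V, f x ≠ 0) : V.card ≤ 3 ^ d * γ.card ^ (d + 1) := by
  classical
  rcases Nat.eq_zero_or_pos γ.card with h0 | hpos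
  · have : V = ∅ := by
      refine Finset.eq_empty_of_forall_notMem fun x hx => ?_
      obtain ⟨p, hp, -⟩ := h.exists_near hd hf (hV x hx)
      rw [Finset.card_eq_zero.1 h0] at hp
      simp at hp
    simp [this]
  have hsub : V ⊆ γ.biUnion fun p => cube γ.card p.1 := by
    intro x hx
    obtain ⟨p, hp, hpx⟩ := h.exists_near hd hf (hV x hx)
    exact Finset.mem_biUnion.2 ⟨p, hp, mem_cube_comm.1 hpx⟩
  calc V.card ≤ _ := Finset.card_le_card hsub
    _ ≤ γ.card * (2 * γ.card + 1) ^ d := Finset.card_biUnion_le_card_mul _ _ _ fun p _ =>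
        (card_cube _ _).le
    _ ≤ γ.card * (3 * γ.card) ^ d := by gcongr; omega
    _ = 3 ^ d * γ.card ^ (d + 1) := by rw [mul_pow]; ring

/-! ### The interaction energy -/

/-- Interaction of a site with all the sites where `f` takes a different value. -/
def siteEnergy {d q : ℕ} (J α : ℝ) (f : Zd d → ZMod q) (x : Zd d) : ENNReal :=
  ∑' y, if f x = f y then 0 else jw d J α x y

/-- Interaction over all ordered pairs of sites where `f` takes different values. -/
def energy {d q : ℕ} (J α : ℝ) (f : Zd d → ZMod q) : ENNReal :=
  ∑' x, siteEnergy J α f x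

/-- Interaction over all ordered pairs of sites where both `f` and `g` take different values. -/
def crossEnergy {d q : ℕ} (J α : ℝ) (f g : Zd d → ZMod q) : ENNReal :=
  ∑' x, ∑' y, if f x = f y ∨ g x = g y then 0 else jw d J α x y

lemma tsum_tsum_le_of_support {d : ℕ} {A F : Zd d → Zd d → ENNReal} (hA : ∀ x y, A x y = A y x)
    (hF : ∀ x y, F x y ≤ A x y) (V : Finset (Zd d))
    (hV : ∀ x y, F x y ≠ 0 → x ∈ V ∨ y ∈ V) :
    ∑' x, ∑' y, F x y ≤ 2 * ∑ x ∈ V, ∑' y, A x y := by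
  classical
  have hpt : ∀ x y, F x y ≤ (if x ∈ V then A x y else 0) + (if y ∈ V then A x y else 0) := by
    intro x y
    by_cases h0 : F x y = 0
    · rw [h0]
      exact zero_le
    · rcases hV x y h0 with h | h
      · rw [if_pos h]
        exact (hF x y).trans le_self_add
      · rw [if_pos h]
        exact (hF x y).trans le_add_self
  have h1 : ∑' x, ∑' y, (if x ∈ V then A x y else 0) = ∑ x ∈ V, ∑' y, A x y := by
    rw [tsum_eq_sum (s := V)]
    · refine Finset.sum_congr rfl fun x hx => ?_
      simp [hx]
    · intro x hx
      simp [hx]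
  have h2 : ∑' x, ∑' y, (if y ∈ V then A x y else 0) = ∑ x ∈ V, ∑' y, A x y := by
    rw [ENNReal.tsum_comm, ← h1]
    simp only [hA]
  calc ∑' x, ∑' y, F x y
      ≤ ∑' x, ∑' y, ((if x ∈ V then A x y else 0) + (if y ∈ V then A x y else 0)) :=
        ENNReal.tsum_le_tsum fun x => ENNReal.tsum_le_tsum fun y => hpt x y
    _ = 2 * ∑ x ∈ V, ∑' y, A x y := by
        simp only [ENNReal.tsum_add]
        rw [h1, h2, two_mul]

lemma energy_lt_top {d q R : ℕ} {J α : ℝ} (hJ : 0 ≤ J) (hα : (d : ℝ) < α) {f : Zd d → ZMod q}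
    (hf : ∀ x, x ∉ cube R 0 → f x = 0) : energy J α f < ⊤ := by
  refine (tsum_tsum_le_of_support (A := jw d J α) (jw_symm J α) ?_ (cube R 0) ?_).trans_lt ?_
  · intro x y
    split_ifs
    · exact zero_le
    · exact le_rfl
  · intro x y h
    by_contra! hxy
    rw [hf x hxy.1, hf y hxy.2] at h
    simp at h
  · refine ENNReal.mul_lt_top (by simp) ?_
    exact ENNReal.sum_lt_top.2 fun x _ => tsum_jw_lt_top hJ hα x

lemma energy_add_le {d q : ℕ} (J α : ℝ) (f g : Zd d → ZMod q) :
    energy J α g + energy J α f ≤ energy J α (f + g) + 2 * crossEnergy J α f g := by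
  simp only [energy, siteEnergy, crossEnergy]
  rw [← ENNReal.tsum_add, ← ENNReal.tsum_mul_left, ← ENNReal.tsum_add]
  refine ENNReal.tsum_le_tsum fun x => ?_
  rw [← ENNReal.tsum_add, ← ENNReal.tsum_mul_left, ← ENNReal.tsum_add]
  refine ENNReal.tsum_le_tsum fun y => ?_
  by_cases h1 : f x = f y
  · simp [h1]
  · by_cases h2 : g x = g y
    · simp [h1, h2]
    · simp only [h1, h2, or_self, if_false]
      rw [← two_mul]
      exact le_add_self

lemma crossEnergy_sum_le {d q : ℕ} {ι : Type*} (J α : ℝ) (f : Zd d → ZMod q) (Q : Finset ι)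
    (g : ι → Zd d → ZMod q) (small : ι → Prop) [DecidablePred small] (N : ℕ)
    (hlarge : ∀ i ∈ Q, ¬ small i → ∀ x y, f x ≠ f y → g i x ≠ g i y → N < nm (x - y)) :
    crossEnergy J α f (∑ i ∈ Q, g i) ≤
      (∑' x, ∑' y, if f x ≠ f y ∧ N < nm (x - y) then jw d J α x y else 0) +
        ∑ i ∈ Q.filter small, crossEnergy J α f (g i) := by
  simp only [crossEnergy]
  have e1 : ∑ i ∈ Q.filter small, ∑' x, ∑' y,
        (if f x = f y ∨ g i x = g i y then 0 else jw d J α x y) =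
      ∑' x, ∑' y, ∑ i ∈ Q.filter small,
        (if f x = f y ∨ g i x = g i y then 0 else jw d J α x y) := by
    rw [← Summable.tsum_finsetSum fun i _ => ENNReal.summable]
    congr 1
    funext x
    rw [← Summable.tsum_finsetSum fun i _ => ENNReal.summable]
  rw [e1, ← ENNReal.tsum_add]
  refine ENNReal.tsum_le_tsum fun x => ?_
  rw [← ENNReal.tsum_add]
  refine ENNReal.tsum_le_tsum fun y => ?_
  by_cases h1 : f x = f y
  · simp [h1]
  by_cases h2 : (∑ i ∈ Q, g i) x = (∑ i ∈ Q, g i) y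
  · simp [h2]
  simp only [h1, h2, or_self, if_false, false_or]
  have hex : ∃ i ∈ Q, g i x ≠ g i y := by
    by_contra! h
    apply h2
    rw [Finset.sum_apply, Finset.sum_apply]
    exact Finset.sum_congr rfl h
  obtain ⟨i, hi, hne⟩ := hex
  by_cases hs : small i
  · refine le_trans ?_ le_add_self
    refine le_trans ?_ (Finset.single_le_sum (fun _ _ => zero_le)
      (Finset.mem_filter.2 ⟨hi, hs⟩))
    simp [hne]
  · rw [if_pos ⟨h1, hlarge i hi hs x y h1 hne⟩]
    exact le_self_add

lemma crossEnergy_le {d q : ℕ} (J α : ℝ) (f g : Zd d → ZMod q) (V : Finset (Zd d))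
    (hV : ∀ x, x ∉ V → g x = 0) :
    crossEnergy J α f g ≤ 2 * ∑ x ∈ V, siteEnergy J α f x := by
  refine tsum_tsum_le_of_support ?_ ?_ V ?_
  · intro x y
    rw [jw_symm]
    simp only [eq_comm]
  · intro x y
    by_cases h : f x = f y
    · simp [h]
    · by_cases h' : g x = g y <;> simp [h, h']
  · intro x y h
    by_contra! hxy
    rw [hV x hxy.1, hV y hxy.2] at h
    simp at h

lemma large_energy_le {d q : ℕ} {J α C : ℝ} (f : Zd d → ZMod q) (V : Finset (Zd d))
    (hV : ∀ x, x ∉ V → f x = 0) (N : ℕ)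
    (hC : ∀ x : Zd d, ∑' y, (if N < nm (x - y) then jw d J α x y else 0) ≤ ENNReal.ofReal C) :
    ∑' x, ∑' y, (if f x ≠ f y ∧ N < nm (x - y) then jw d J α x y else 0) ≤
      2 * (V.card * ENNReal.ofReal C) := by
  refine (tsum_tsum_le_of_support
    (A := fun x y => if N < nm (x - y) then jw d J α x y else 0) ?_ ?_ V ?_).trans ?_
  · intro x y
    rw [jw_symm, nm_sub_comm]
  · intro x y
    by_cases h : f x = f y
    · simp [h]
    · simp [h]
  · intro x y h
    by_contra! hxy
    rw [hV x hxy.1, hV y hxy.2] at h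
    simp at h
  · gcongr
    rw [← nsmul_eq_mul]
    exact Finset.sum_le_card_nsmul _ _ _ fun x _ => hC x

lemma IsGrad.card_le_energy {d q : ℕ} {J α : ℝ} {γ : Finset (Edge d q)} {f : Zd d → ZMod q}
    (h : IsGrad γ f) : γ.card * ENNReal.ofReal J ≤ energy J α f := by
  classical
  set F : Zd d × Zd d → ENNReal := fun p => if f p.1 = f p.2 then 0 else jw d J α p.1 p.2 with hF
  set T : Edge d q → Zd d × Zd d := fun p => (p.1, p.1 + ee p.2.1) with hT
  have hinj : Set.InjOn T γ := by
    rintro ⟨x, i, v⟩ hp ⟨x', i', v'⟩ hp' heq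
    simp only [hT, Prod.mk.injEq] at heq
    obtain ⟨rfl, h2⟩ := heq
    have hii : i = i' := by
      have h3 := congrFun (add_left_cancel h2) i
      by_contra hne
      simp [Pi.single_eq_of_ne hne] at h3
    subst hii
    rw [← ((h _ _ _).1 hp).1, ← ((h _ _ _).1 hp').1]
  calc (γ.card : ENNReal) * ENNReal.ofReal J = ∑ _p ∈ γ, ENNReal.ofReal J := by
        rw [Finset.sum_const, nsmul_eq_mul]
    _ = ∑ p ∈ γ, F (T p) := by
        refine Finset.sum_congr rfl ?_
        rintro ⟨x, i, v⟩ hp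
        obtain ⟨h1, h2⟩ := (h _ _ _).1 hp
        have hne : f x ≠ f (x + ee i) := by
          intro h3
          rw [h3, sub_self] at h1
          exact h2 h1.symm
        simp only [hF, hT, hne, if_false, jw, Jcoup_ee]
    _ = ∑ p ∈ γ.image T, F p := (Finset.sum_image hinj).symm
    _ ≤ ∑' p, F p := ENNReal.sum_le_tsum _
    _ = energy J α f := ENNReal.tsum_prod' (f := F)

/-- Far from the contour, `siteEnergy` varies slowly. -/
lemma siteEnergy_le_mul {d q : ℕ} {J α : ℝ} (hJ : 0 ≤ J) (hα : 0 ≤ α) {f : Zd d → ZMod q}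
    {γ : Finset (Edge d q)} (h : IsGrad γ f) {s : ℕ} {x x' : Zd d}
    (hx : ∀ p ∈ γ, s < nm (p.1 - x)) (hx' : nm (x' - x) ≤ s) :
    siteEnergy J α f x ≤ ENNReal.ofReal (2 ^ α) * siteEnergy J α f x' := by
  have far : ∀ y, f x ≠ f y → s < nm (y - x) := by
    intro y hy
    obtain ⟨z, i, hz, hz'⟩ := exists_edge_of_ne f y _ x rfl hy
    have h1 := hx (z, i, f (z + ee i) - f z) ((h _ _ _).2 ⟨rfl, sub_ne_zero.2 hz⟩)
    have h2 : nm (z - x) ≤ nm (x - y) := nm_sub_le_of_hull hz' fun j =>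
      ⟨min_le_left _ _, le_max_left _ _⟩
    rw [nm_sub_comm y]
    exact h1.trans_le h2
  have heq : f x' = f x := by
    by_contra hne
    exact absurd (far x' (Ne.symm hne)) (not_lt.2 hx')
  rw [siteEnergy, siteEnergy, ← ENNReal.tsum_mul_left]
  refine ENNReal.tsum_le_tsum fun y => ?_
  rw [heq]
  split_ifs with hy
  · exact zero_le
  · rw [jw, jw, ← ENNReal.ofReal_mul (by positivity)]
    refine ENNReal.ofReal_le_ofReal (Jcoup_le_mul hJ hα ?_ ?_)
    · rintro rfl
      exact hy heq.symm
    · have h1 := far y hy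
      have h2 := nm_sub_le x' x y
      rw [nm_sub_comm] at h1
      omega

lemma card_mul_inv_le {d a k0 n c : ℕ} (hd : 1 ≤ d) (ha : d + 3 ≤ a) (hk : 1 ≤ k0) (hn : 1 ≤ n)
    (hc : c ≤ 3 ^ d * n ^ (d + 1)) :
    (c : ENNReal) * (((2 * (k0 * n ^ a) + 1) ^ d : ℕ) : ENNReal)⁻¹ ≤
      ENNReal.ofReal (3 ^ d / k0 * ((n : ℝ) ^ 2)⁻¹) := by
  have hnat : c * (k0 * n ^ 2) ≤ 3 ^ d * (2 * (k0 * n ^ a) + 1) ^ d := by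
    calc c * (k0 * n ^ 2) ≤ 3 ^ d * n ^ (d + 1) * (k0 * n ^ 2) := by gcongr
      _ = 3 ^ d * (k0 ^ 1 * n ^ (d + 3)) := by ring
      _ ≤ 3 ^ d * (k0 ^ d * n ^ (a * d)) := by
          have h2 : d + 3 ≤ a * d := by nlinarith
          gcongr
      _ = 3 ^ d * (k0 * n ^ a) ^ d := by rw [mul_pow, pow_mul]
      _ ≤ _ := by gcongr; omega
  have hpos : 0 < (2 * (k0 * n ^ a) + 1) ^ d := by positivity
  rw [← div_eq_mul_inv, ← ENNReal.ofReal_natCast, ← ENNReal.ofReal_natCast,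
    ← ENNReal.ofReal_div_of_pos (by exact_mod_cast hpos)]
  refine ENNReal.ofReal_le_ofReal ?_
  have hk' : (0 : ℝ) < k0 := by exact_mod_cast hk
  have hn' : (0 : ℝ) < n := by exact_mod_cast hn
  rw [← div_eq_mul_inv, div_div, div_le_div_iff₀ (by exact_mod_cast hpos) (by positivity)]
  exact_mod_cast hnat

/-- Averaging over cubes: sites near small contours carry a small part of a slowly varying sum. -/
lemma sum_sum_le_mul_tsum {d a k0 : ℕ} {ι : Type*} (hd : 1 ≤ d) (ha : d + 3 ≤ a) (hk : 1 ≤ k0)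
    (φ : Zd d → ENNReal) (c : ENNReal) (Q : Finset ι) (V : ι → Finset (Zd d)) (n : ι → ℕ)
    (hn : ∀ i ∈ Q, 1 ≤ n i)
    (hV : ∀ i ∈ Q, (V i).card ≤ 3 ^ d * n i ^ (d + 1))
    (hφ : ∀ i ∈ Q, ∀ x ∈ V i, ∀ y ∈ cube (k0 * n i ^ a) x, φ x ≤ c * φ y)
    (hsep : ∀ i ∈ Q, ∀ j ∈ Q, n i = n j → ∀ y, (∃ x ∈ V i, y ∈ cube (k0 * n i ^ a) x) →
      (∃ x ∈ V j, y ∈ cube (k0 * n j ^ a) x) → i = j) :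
    ∑ i ∈ Q, ∑ x ∈ V i, φ x ≤ c * (ENNReal.ofReal (3 ^ d / k0 * 2) * ∑' y, φ y) := by
  classical
  set w : ι → ENNReal := fun i => (((2 * (k0 * n i ^ a) + 1) ^ d : ℕ) : ENNReal)⁻¹ with hw
  have hpt : ∀ i ∈ Q, ∀ x ∈ V i,
      φ x ≤ c * ∑' y, w i * (if y ∈ cube (k0 * n i ^ a) x then 1 else 0) * φ y := by
    intro i hi x hx
    set r := k0 * n i ^ a
    have hcard : w i * ((2 * r + 1) ^ d : ℕ) = 1 :=
      ENNReal.inv_mul_cancel (by positivity) (ENNReal.natCast_ne_top _)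
    calc φ x = w i * ((2 * r + 1) ^ d : ℕ) * φ x := by rw [hcard, one_mul]
      _ = w i * ∑ _y ∈ cube r x, φ x := by
          rw [Finset.sum_const, card_cube, nsmul_eq_mul, mul_assoc]
      _ ≤ w i * ∑ y ∈ cube r x, c * φ y := by
          gcongr with y hy
          exact hφ i hi x hx y hy
      _ = c * ∑ y ∈ cube r x, w i * (if y ∈ cube r x then 1 else 0) * φ y := by
          rw [Finset.mul_sum, Finset.mul_sum]
          refine Finset.sum_congr rfl fun y hy => ?_
          rw [if_pos hy]
          ring
      _ ≤ _ := by
          gcongr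
          exact ENNReal.sum_le_tsum _
  have hbr : ∀ y, ∑ i ∈ Q, ∑ x ∈ V i, w i * (if y ∈ cube (k0 * n i ^ a) x then 1 else 0) ≤
      ENNReal.ofReal (3 ^ d / k0 * 2) := by
    intro y
    set Qy := Q.filter fun i => ∃ x ∈ V i, y ∈ cube (k0 * n i ^ a) x with hQy
    have hle : ∀ i ∈ Qy, ∑ x ∈ V i, w i * (if y ∈ cube (k0 * n i ^ a) x then 1 else 0) ≤
        ENNReal.ofReal (3 ^ d / k0 * ((n i : ℝ) ^ 2)⁻¹) := by
      intro i hi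
      have hiQ := (Finset.mem_filter.1 hi).1
      calc _ ≤ ∑ _x ∈ V i, w i := Finset.sum_le_sum fun x _ => by split_ifs <;> simp
        _ = (V i).card * w i := by rw [Finset.sum_const, nsmul_eq_mul]
        _ ≤ _ := card_mul_inv_le hd ha hk (hn i hiQ) (hV i hiQ)
    have hinj : Set.InjOn n Qy := by
      intro i hi j hj hij
      obtain ⟨hi1, hi2⟩ := Finset.mem_filter.1 hi
      obtain ⟨hj1, hj2⟩ := Finset.mem_filter.1 hj
      exact hsep i hi1 j hj1 hij y hi2 hj2
    set N := Qy.sup n + 1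
    have hsub : Qy.image n ⊆ Finset.Ioo 0 N := by
      intro m hm
      obtain ⟨i, hi, rfl⟩ := Finset.mem_image.1 hm
      have h1 := hn i (Finset.mem_filter.1 hi).1
      have h2 : n i ≤ Qy.sup n := Finset.le_sup hi
      rw [Finset.mem_Ioo]
      omega
    calc ∑ i ∈ Q, ∑ x ∈ V i, w i * (if y ∈ cube (k0 * n i ^ a) x then 1 else 0)
        = ∑ i ∈ Qy, ∑ x ∈ V i, w i * (if y ∈ cube (k0 * n i ^ a) x then 1 else 0) := by
          symm
          refine Finset.sum_filter_of_ne fun i hi hne => ?_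
          by_contra! hcon
          refine hne (Finset.sum_eq_zero fun x hx => ?_)
          simp [hcon x hx]
      _ ≤ ∑ i ∈ Qy, ENNReal.ofReal (3 ^ d / k0 * ((n i : ℝ) ^ 2)⁻¹) := Finset.sum_le_sum hle
      _ = ENNReal.ofReal (∑ i ∈ Qy, 3 ^ d / k0 * ((n i : ℝ) ^ 2)⁻¹) :=
          (ENNReal.ofReal_sum_of_nonneg fun i _ => by positivity).symm
      _ ≤ _ := by
          refine ENNReal.ofReal_le_ofReal ?_
          rw [← Finset.mul_sum]
          refine mul_le_mul_of_nonneg_left ?_ (by positivity)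
          calc ∑ i ∈ Qy, ((n i : ℝ) ^ 2)⁻¹ = ∑ m ∈ Qy.image n, ((m : ℝ) ^ 2)⁻¹ :=
                (Finset.sum_image (f := fun m : ℕ => ((m : ℝ) ^ 2)⁻¹) hinj).symm
            _ ≤ ∑ m ∈ Finset.Ioo 0 N, ((m : ℝ) ^ 2)⁻¹ :=
                Finset.sum_le_sum_of_subset_of_nonneg hsub fun m _ _ => by positivity
            _ ≤ 2 := by simpa using sum_Ioo_inv_sq_le (α := ℝ) 0 N
  calc ∑ i ∈ Q, ∑ x ∈ V i, φ x
      ≤ ∑ i ∈ Q, ∑ x ∈ V i,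
          c * ∑' y, w i * (if y ∈ cube (k0 * n i ^ a) x then 1 else 0) * φ y :=
        Finset.sum_le_sum fun i hi => Finset.sum_le_sum fun x hx => hpt i hi x hx
    _ = c * ∑' y, (∑ i ∈ Q, ∑ x ∈ V i,
          w i * (if y ∈ cube (k0 * n i ^ a) x then 1 else 0)) * φ y := by
        symm
        simp only [Finset.sum_mul]
        rw [Summable.tsum_finsetSum fun i _ => ENNReal.summable, Finset.mul_sum]
        refine Finset.sum_congr rfl fun i _ => ?_
        rw [Summable.tsum_finsetSum fun i _ => ENNReal.summable, Finset.mul_sum]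
    _ ≤ c * ∑' y, ENNReal.ofReal (3 ^ d / k0 * 2) * φ y := by
        gcongr with y
        exact hbr y
    _ = _ := by rw [ENNReal.tsum_mul_left]

/-! ### Erasing a contour lowers the energy -/

lemma exists_erase_params {d : ℕ} {J α C : ℝ} (hd : 2 ≤ d) (hJ : 0 < J) (hα : (d : ℝ) < α) :
    ∃ k0 a : ℕ, 1 ≤ k0 ∧ d + 3 ≤ a ∧ (d : ℝ) ≤ a * ((α - d) / 2) ∧
      32 * 2 ^ α * 3 ^ d ≤ (k0 : ℝ) ∧
      16 * 3 ^ d * C ≤ J * ((4 * d * k0 : ℕ) : ℝ) ^ ((α - d) / 2) := by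
  have hs : 0 < (α - d) / 2 := by linarith
  obtain ⟨a0, ha0⟩ := exists_nat_ge ((d : ℝ) / ((α - d) / 2))
  have ht : Tendsto (fun k : ℕ => J * (k : ℝ) ^ ((α - d) / 2)) atTop atTop :=
    ((tendsto_rpow_atTop hs).comp tendsto_natCast_atTop_atTop).const_mul_atTop hJ
  obtain ⟨k0, h1, h2, h3⟩ := ((eventually_ge_atTop 1).and
    ((tendsto_natCast_atTop_atTop.eventually_ge_atTop (32 * 2 ^ α * 3 ^ d : ℝ)).and
      (ht.eventually_ge_atTop (16 * 3 ^ d * C)))).exists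
  refine ⟨k0, max (d + 3) a0, h1, le_max_left _ _, ?_, h2, h3.trans ?_⟩
  · rw [div_le_iff₀ hs] at ha0
    refine ha0.trans ?_
    gcongr
    exact le_max_right _ _
  · refine mul_le_mul_of_nonneg_left (Real.rpow_le_rpow (by positivity) ?_ hs.le) hJ.le
    exact_mod_cast Nat.le_mul_of_pos_left k0 (by omega : 0 < 4 * d)

lemma pow_mul_rpow_neg_le {d a m M : ℕ} {s : ℝ} (hm : 1 ≤ m)
    (has : (d : ℝ) ≤ a * s) :
    (m : ℝ) ^ (d + 1) * (((M * m ^ a : ℕ) : ℝ) ^ (-s)) ≤ m * (M : ℝ) ^ (-s) := by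
  have hm' : (1 : ℝ) ≤ m := by exact_mod_cast hm
  have hm0 : (0 : ℝ) < m := by linarith
  have h1 : (m : ℝ) ^ d * ((m : ℝ) ^ a) ^ (-s) ≤ 1 := by
    rw [← Real.rpow_natCast, ← Real.rpow_natCast, ← Real.rpow_mul hm0.le, ← Real.rpow_add hm0]
    exact Real.rpow_le_one_of_one_le_of_nonpos hm' (by linarith)
  push_cast
  rw [Real.mul_rpow (by positivity) (by positivity)]
  have h2 : (0 : ℝ) ≤ m * (M : ℝ) ^ (-s) := by positivity
  calc (m : ℝ) ^ (d + 1) * ((M : ℝ) ^ (-s) * ((m : ℝ) ^ a) ^ (-s))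
      = m * (M : ℝ) ^ (-s) * ((m : ℝ) ^ d * ((m : ℝ) ^ a) ^ (-s)) := by ring
    _ ≤ _ := mul_le_of_le_one_right h2 h1

/-- With suitable merging parameters, erasing any contour of a configuration lowers the energy by
at least half of the energy of that contour. -/
theorem exists_energy_erase_le {d : ℕ} (q : ℕ) {J α : ℝ} (hd : 2 ≤ d) (hJ : 0 < J)
    (hα : (d : ℝ) < α) :
    ∃ M a : ℕ, 2 ≤ M ∧ 1 ≤ a ∧ ∀ (R : ℕ) (P : Finset (Finset (Edge d q)))
      (g : Finset (Edge d q) → Zd d → ZMod q),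
      (∀ γ ∈ P, Built edist M a γ ∧ IsGrad γ (g γ) ∧ ∀ x, x ∉ cube R 0 → g γ x = 0) →
      Separated edist M a P → ∀ γ ∈ P,
        energy J α (∑ γ' ∈ P.erase γ, g γ') + ENNReal.ofReal (1 / 2) * energy J α (g γ) ≤
          energy J α (∑ γ' ∈ P, g γ') := by
  classical
  have hα0 : 0 ≤ α := (Nat.cast_nonneg d).trans hα.le
  obtain ⟨C, hC0, hC⟩ := exists_tail_bound hJ.le hα
  obtain ⟨k0, a, hk, ha, has, hk2, hMs⟩ := exists_erase_params (C := C) hd hJ hα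
  set s := (α - d) / 2 with hs
  have hs0 : 0 < s := by rw [hs]; linarith
  set M := 4 * d * k0 with hM
  have hM1 : 8 ≤ M := by rw [hM]; nlinarith
  refine ⟨M, a, by omega, by omega, ?_⟩
  intro R P g hP hsep γ hγ
  obtain ⟨hBγ, hGγ, hzγ⟩ := hP γ hγ
  set m := γ.card with hm
  have hm1 : 1 ≤ m := hBγ.card_pos
  set Φ := energy J α (g γ) with hΦ
  have hΦtop : Φ < ⊤ := energy_lt_top hJ.le hα hzγ
  have hΦm : (m : ENNReal) * ENNReal.ofReal J ≤ Φ := hGγ.card_le_energy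
  set V : Finset (Edge d q) → Finset (Zd d) := fun γ' => (cube R 0).filter fun x => g γ' x ≠ 0
    with hV
  have hVz : ∀ γ' ∈ P, ∀ x, x ∉ V γ' → g γ' x = 0 := by
    intro γ' hγ' x hx
    by_contra hne
    refine hx (Finset.mem_filter.2 ⟨?_, hne⟩)
    by_contra hxc
    exact hne ((hP γ' hγ').2.2 x hxc)
  have hVc : ∀ γ' ∈ P, (V γ').card ≤ 3 ^ d * γ'.card ^ (d + 1) := fun γ' hγ' =>
    (hP γ' hγ').2.1.card_support_le hd (hP γ' hγ').2.2 fun x hx => (Finset.mem_filter.1 hx).2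
  have hVnear : ∀ γ' ∈ P, ∀ x ∈ V γ', ∃ p ∈ γ', nm (p.1 - x) ≤ d * γ'.card := by
    intro γ' hγ' x hx
    obtain ⟨p, hp, hpx⟩ := (hP γ' hγ').2.1.exists_near hd (hP γ' hγ').2.2
      (Finset.mem_filter.1 hx).2
    exact ⟨p, hp, nm_le_of_mem_cube hpx⟩
  have hpow : ∀ n : ℕ, 1 ≤ n → n ≤ k0 * n ^ a := by
    intro n hn
    calc n ≤ n ^ a := Nat.le_self_pow (by omega) n
      _ ≤ k0 * n ^ a := Nat.le_mul_of_pos_left _ hk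
  have hMn : ∀ n : ℕ, M * n ^ a = 4 * (d * (k0 * n ^ a)) := fun n => by rw [hM]; ring
  set N := M * m ^ a with hN
  have hN1 : 1 ≤ N := Nat.mul_pos (by omega) (Nat.pow_pos hm1)
  have hcross : crossEnergy J α (g γ) (∑ γ' ∈ P.erase γ, g γ') ≤
      ENNReal.ofReal (1 / 4) * Φ := by
    have hlarge : ∀ γ' ∈ P.erase γ, ¬ γ'.card < m → ∀ x y, g γ x ≠ g γ y → g γ' x ≠ g γ' y →
        N < nm (x - y) := by
      intro γ' hγ' hcard x y h1 h2
      obtain ⟨hne, hγ'P⟩ := Finset.mem_erase.1 hγ'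
      obtain ⟨z, i, hz, hz'⟩ := exists_edge_of_ne (g γ) y _ x rfl h1
      obtain ⟨w, j, hw, hw'⟩ := exists_edge_of_ne (g γ') y _ x rfl h2
      have h3 := hsep γ hγ γ' hγ'P hne.symm _ ((hGγ _ _ _).2 ⟨rfl, sub_ne_zero.2 hz⟩) _
        (((hP γ' hγ'P).2.1 _ _ _).2 ⟨rfl, sub_ne_zero.2 hw⟩)
      rw [min_eq_left (by omega)] at h3
      exact h3.trans_le (nm_sub_le_of_hull hz' hw')
    refine (crossEnergy_sum_le J α (g γ) (P.erase γ) g (fun γ' => γ'.card < m) N hlarge).trans ?_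
    set Q := (P.erase γ).filter fun γ' => γ'.card < m with hQ
    have hQP : ∀ γ' ∈ Q, γ' ≠ γ ∧ γ' ∈ P ∧ γ'.card < m := by
      intro γ' h
      obtain ⟨h1, h2⟩ := Finset.mem_filter.1 h
      obtain ⟨h3, h4⟩ := Finset.mem_erase.1 h1
      exact ⟨h3, h4, h2⟩
    have hbig : ∑' x, ∑' y, (if g γ x ≠ g γ y ∧ N < nm (x - y) then jw d J α x y else 0) ≤
        ENNReal.ofReal (1 / 8) * Φ := by
      refine (large_energy_le (g γ) (V γ) (hVz γ hγ) N (hC N hN1)).trans ?_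
      refine le_trans ?_ (mul_le_mul_right hΦm _)
      rw [← ENNReal.ofReal_natCast, ← ENNReal.ofReal_natCast m,
        ← ENNReal.ofReal_mul (by positivity), ← ENNReal.ofReal_mul (by positivity),
        ← ENNReal.ofReal_mul (by positivity),
        show (2 : ENNReal) = ENNReal.ofReal 2 by simp, ← ENNReal.ofReal_mul (by positivity)]
      refine ENNReal.ofReal_le_ofReal ?_
      have hc : ((V γ).card : ℝ) ≤ 3 ^ d * (m : ℝ) ^ (d + 1) := by exact_mod_cast hVc γ hγ
      have hp := pow_mul_rpow_neg_le (M := M) hm1 has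
      have hM0 : (0 : ℝ) < M := by exact_mod_cast (by omega : 0 < M)
      have hMs' : 16 * 3 ^ d * C * (M : ℝ) ^ (-s) ≤ J := by
        rw [Real.rpow_neg hM0.le, ← div_eq_mul_inv, div_le_iff₀ (by positivity)]
        exact hMs
      calc 2 * (((V γ).card : ℝ) * (C * (N : ℝ) ^ (-s)))
          ≤ 2 * ((3 ^ d * (m : ℝ) ^ (d + 1)) * (C * (N : ℝ) ^ (-s))) := by gcongr
        _ = 2 * 3 ^ d * C * ((m : ℝ) ^ (d + 1) * (N : ℝ) ^ (-s)) := by ring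
        _ ≤ 2 * 3 ^ d * C * (m * (M : ℝ) ^ (-s)) := by gcongr
        _ = 1 / 8 * (m * (16 * 3 ^ d * C * (M : ℝ) ^ (-s))) := by ring
        _ ≤ 1 / 8 * (m * J) := by gcongr
    have hsmall : ∑ γ' ∈ Q, crossEnergy J α (g γ) (g γ') ≤ ENNReal.ofReal (1 / 8) * Φ := by
      have hsum : ∑ γ' ∈ Q, ∑ x ∈ V γ', siteEnergy J α (g γ) x ≤
          ENNReal.ofReal (2 ^ α) * (ENNReal.ofReal (3 ^ d / k0 * 2) * Φ) := by
        refine sum_sum_le_mul_tsum (by omega) ha hk _ _ Q V Finset.card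
          (fun γ' h => (hP γ' (hQP γ' h).2.1).1.card_pos) (fun γ' h => hVc γ' (hQP γ' h).2.1)
          ?_ ?_
        · intro γ' hγ' x hx y hy
          obtain ⟨hne, hγ'P, hlt⟩ := hQP γ' hγ'
          have hn1 : 1 ≤ γ'.card := (hP γ' hγ'P).1.card_pos
          refine siteEnergy_le_mul hJ.le hα0 hGγ (s := d * (k0 * γ'.card ^ a)) ?_
            (nm_le_of_mem_cube hy)
          intro p hp
          obtain ⟨p', hp', hpx⟩ := hVnear γ' hγ'P x hx
          have h3 := hsep γ hγ γ' hγ'P hne.symm p hp p' hp'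
          rw [min_eq_right hlt.le, hMn] at h3
          have h4 : edist p p' ≤ nm (p.1 - x) + nm (x - p'.1) := nm_sub_le _ _ _
          rw [nm_sub_comm x] at h4
          have h5 := Nat.mul_le_mul_left d (hpow _ hn1)
          omega
        · rintro γ1 hγ1 γ2 hγ2 hcard y ⟨x1, hx1, hy1⟩ ⟨x2, hx2, hy2⟩
          by_contra hne
          obtain ⟨p1, hp1, hpx1⟩ := hVnear γ1 (hQP _ hγ1).2.1 x1 hx1
          obtain ⟨p2, hp2, hpx2⟩ := hVnear γ2 (hQP _ hγ2).2.1 x2 hx2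
          have h3 := hsep γ1 (hQP _ hγ1).2.1 γ2 (hQP _ hγ2).2.1 hne p1 hp1 p2 hp2
          have hn1 : 1 ≤ γ1.card := (hP γ1 (hQP _ hγ1).2.1).1.card_pos
          rw [← hcard] at hpx2 hy2
          rw [← hcard, min_self, hMn] at h3
          have h5 := Nat.mul_le_mul_left d (hpow _ hn1)
          have h6 := nm_le_of_mem_cube hy1
          have h7 := nm_le_of_mem_cube hy2
          have h8 : edist p1 p2 ≤ nm (p1.1 - x1) + nm (x1 - p2.1) := nm_sub_le _ _ _
          have h9 := nm_sub_le x1 y p2.1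
          have h10 := nm_sub_le y x2 p2.1
          rw [nm_sub_comm x1 y] at h9
          rw [nm_sub_comm x2] at h10
          omega
      calc ∑ γ' ∈ Q, crossEnergy J α (g γ) (g γ')
          ≤ ∑ γ' ∈ Q, 2 * ∑ x ∈ V γ', siteEnergy J α (g γ) x :=
            Finset.sum_le_sum fun γ' h => crossEnergy_le J α _ _ _ (hVz γ' (hQP γ' h).2.1)
        _ = 2 * ∑ γ' ∈ Q, ∑ x ∈ V γ', siteEnergy J α (g γ) x := by rw [Finset.mul_sum]
        _ ≤ 2 * (ENNReal.ofReal (2 ^ α) * (ENNReal.ofReal (3 ^ d / k0 * 2) * Φ)) := by gcongr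
        _ = ENNReal.ofReal (2 * (2 ^ α * (3 ^ d / k0 * 2))) * Φ := by
            rw [ENNReal.ofReal_mul (p := 2) (by norm_num),
              ENNReal.ofReal_mul (p := 2 ^ α) (by positivity), ENNReal.ofReal_ofNat]
            ring
        _ ≤ ENNReal.ofReal (1 / 8) * Φ := by
            gcongr
            have hk' : (0 : ℝ) < k0 := by exact_mod_cast hk
            rw [show 2 * ((2 : ℝ) ^ α * (3 ^ d / k0 * 2)) = (4 * 2 ^ α * 3 ^ d) / k0 by ring,
              div_le_iff₀ hk']
            linarith
    calc _ ≤ ENNReal.ofReal (1 / 8) * Φ + ENNReal.ofReal (1 / 8) * Φ := add_le_add hbig hsmall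
      _ = ENNReal.ofReal (1 / 4) * Φ := by
          rw [← add_mul, ← ENNReal.ofReal_add (by norm_num) (by norm_num)]
          norm_num
  have hsplit := energy_add_le J α (g γ) (∑ γ' ∈ P.erase γ, g γ')
  rw [Finset.add_sum_erase P g hγ] at hsplit
  have hhalf : Φ = ENNReal.ofReal (1 / 2) * Φ + ENNReal.ofReal (1 / 2) * Φ := by
    rw [← add_mul, ← ENNReal.ofReal_add (by norm_num) (by norm_num)]
    norm_num
  have h2c : 2 * crossEnergy J α (g γ) (∑ γ' ∈ P.erase γ, g γ') ≤
      ENNReal.ofReal (1 / 2) * Φ := by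
    refine (mul_le_mul_right hcross 2).trans_eq ?_
    rw [← mul_assoc, show (2 : ENNReal) = ENNReal.ofReal 2 by simp,
      ← ENNReal.ofReal_mul (by norm_num)]
    norm_num
  have hfin : ENNReal.ofReal (1 / 2) * Φ ≠ ⊤ := (ENNReal.mul_lt_top (by simp) hΦtop).ne
  rw [← ENNReal.add_le_add_iff_right hfin, add_assoc, ← hhalf]
  exact hsplit.trans (by gcongr)

/-! ### The Hamiltonian in terms of the energy -/

lemma tsum_eq_sum_add_tsum_ite {ι : Type*} [DecidableEq ι] (F : ι → ENNReal) (Λ : Finset ι) :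
    ∑' x, F x = ∑ x ∈ Λ, F x + ∑' x, if x ∈ Λ then 0 else F x := by
  have h1 : ∑ x ∈ Λ, F x = ∑' x, if x ∈ Λ then F x else 0 := by
    rw [tsum_eq_sum (s := Λ) fun x hx => if_neg hx]
    exact Finset.sum_congr rfl fun x hx => (if_pos hx).symm
  rw [h1, ← ENNReal.tsum_add]
  refine tsum_congr fun x => ?_
  split_ifs <;> simp

lemma energy_eq_of_eqOn_compl {d q : ℕ} (J α : ℝ) {Λ : Finset (Zd d)} {n : ZMod q}
    {σ : Zd d → ZMod q} (hσ : ∀ x, x ∉ Λ → σ x = n) :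
    energy J α σ = ∑ x ∈ Λ, ∑ y ∈ Λ, (if σ x = σ y then 0 else jw d J α x y) +
      2 * ∑ x ∈ Λ, ∑' y, (if y ∈ Λ then 0 else if σ x = n then 0 else jw d J α x y) := by
  have hsite : ∀ x, siteEnergy J α σ x = ∑ y ∈ Λ, (if σ x = σ y then 0 else jw d J α x y) +
      ∑' y, (if y ∈ Λ then 0 else if σ x = n then 0 else jw d J α x y) := by
    intro x
    rw [siteEnergy, tsum_eq_sum_add_tsum_ite _ Λ]
    congr 1
    refine tsum_congr fun y => ?_
    by_cases hy : y ∈ Λ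
    · simp [hy]
    · simp [hy, hσ y hy]
  have hout : ∑' x, (if x ∈ Λ then 0 else siteEnergy J α σ x) =
      ∑ x ∈ Λ, ∑' y, (if y ∈ Λ then 0 else if σ x = n then 0 else jw d J α x y) := by
    calc ∑' x, (if x ∈ Λ then 0 else siteEnergy J α σ x)
        = ∑' x, ∑' y, (if x ∈ Λ then 0 else if σ y = n then 0 else jw d J α y x) := by
          refine tsum_congr fun x => ?_
          by_cases hx : x ∈ Λ
          · simp [hx]
          · simp only [hx, if_false, siteEnergy, hσ x hx, jw_symm J α x, eq_comm]
      _ = ∑' y, ∑' x, (if x ∈ Λ then 0 else if σ y = n then 0 else jw d J α y x) :=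
          ENNReal.tsum_comm
      _ = _ := by
          refine tsum_eq_sum fun y hy => ?_
          simp [hσ y hy]
  rw [energy, tsum_eq_sum_add_tsum_ite _ Λ, hout, Finset.sum_congr rfl fun x _ => hsite x,
    Finset.sum_add_distrib, add_assoc, two_mul]

lemma energy_add_const {d q : ℕ} (J α : ℝ) (f : Zd d → ZMod q) (n : ZMod q) :
    energy J α (fun x => f x + n) = energy J α f := by
  simp only [energy, siteEnergy, add_left_inj]

/-- The ground state energy of the zero-field Hamiltonian with a constant boundary condition. -/
def groundEnergy (d : ℕ) (J α : ℝ) (Λ : Finset (Zd d)) : ℝ :=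
  -(1 / 2) * (∑ x ∈ Λ, ∑ y ∈ Λ, Jcoup d J α x y)
    - ∑ x ∈ Λ, ∑' y, (if y ∈ Λ then 0 else Jcoup d J α x y)

lemma pottsHam_eq {d q : ℕ} {J α : ℝ} (hJ : 0 ≤ J) (hα : (d : ℝ) < α)
    (h : Zd d → ZMod q → ℝ) {Λ : Finset (Zd d)} {n : ZMod q}
    {σ : Zd d → ZMod q} (hσ : ∀ x, x ∉ Λ → σ x = n) :
    pottsHam d q (Jcoup d J α) h Λ (fun _ => n) σ =
      groundEnergy d J α Λ + 1 / 2 * (energy J α σ).toReal - ∑ x ∈ Λ, h x (σ x) := by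
  have hsum : ∀ (x : Zd d) (p : Zd d → Prop) [DecidablePred p],
      Summable fun y => if p y then 0 else Jcoup d J α x y := by
    intro x p _
    refine Summable.of_nonneg_of_le (fun y => ?_) (fun y => ?_) (summable_Jcoup hJ hα x)
    · split_ifs
      · exact le_rfl
      · exact Jcoup_nonneg hJ _ _ _
    · split_ifs
      · exact Jcoup_nonneg hJ _ _ _
      · exact le_rfl
  have htop : ∀ (x : Zd d) (p : Zd d → Prop) [DecidablePred p],
      ∑' y, (if p y then 0 else jw d J α x y) ≠ ⊤ := by
    intro x p _
    refine ((ENNReal.tsum_le_tsum fun y => ?_).trans_lt (tsum_jw_lt_top hJ hα x)).ne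
    split_ifs
    · exact zero_le
    · exact le_rfl
  have hj : ∀ x y, jw d J α x y ≠ ⊤ := fun x y => ENNReal.ofReal_ne_top
  have hjr : ∀ x y, (jw d J α x y).toReal = Jcoup d J α x y := fun x y =>
    ENNReal.toReal_ofReal (Jcoup_nonneg hJ _ _ _)
  have hor : ∀ (x y : Zd d), (if y ∈ Λ then 0 else if σ x = n then 0 else jw d J α x y) =
      (if y ∈ Λ ∨ σ x = n then 0 else jw d J α x y) := by
    intro x y
    by_cases h1 : y ∈ Λ <;> simp [h1]
  have hS : (∑ x ∈ Λ, ∑ y ∈ Λ, (if σ x = σ y then 0 else jw d J α x y)).toReal =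
      ∑ x ∈ Λ, ∑ y ∈ Λ, (if σ x = σ y then 0 else Jcoup d J α x y) := by
    rw [ENNReal.toReal_sum]
    · refine Finset.sum_congr rfl fun x _ => ?_
      rw [ENNReal.toReal_sum]
      · refine Finset.sum_congr rfl fun y _ => ?_
        split_ifs <;> simp [hjr]
      · intro y _
        split_ifs <;> simp [hj]
    · intro x _
      refine ENNReal.sum_ne_top.2 fun y _ => ?_
      split_ifs <;> simp [hj]
  have hB : (∑ x ∈ Λ, ∑' y, (if y ∈ Λ then 0 else if σ x = n then 0 else jw d J α x y)).toReal =
      ∑ x ∈ Λ, ∑' y, (if y ∈ Λ ∨ σ x = n then 0 else Jcoup d J α x y) := by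
    simp only [hor]
    rw [ENNReal.toReal_sum fun x _ => htop x _]
    refine Finset.sum_congr rfl fun x _ => ?_
    rw [ENNReal.tsum_toReal_eq]
    · refine tsum_congr fun y => ?_
      split_ifs <;> simp [hjr]
    · intro y
      split_ifs <;> simp [hj]
  have hE : (energy J α σ).toReal =
      ∑ x ∈ Λ, ∑ y ∈ Λ, (if σ x = σ y then 0 else Jcoup d J α x y) +
        2 * ∑ x ∈ Λ, ∑' y, (if y ∈ Λ ∨ σ x = n then 0 else Jcoup d J α x y) := by
    rw [energy_eq_of_eqOn_compl J α hσ, ENNReal.toReal_add, hS, ENNReal.toReal_mul, hB,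
      ENNReal.toReal_ofNat]
    · refine ENNReal.sum_ne_top.2 fun x _ => ENNReal.sum_ne_top.2 fun y _ => ?_
      split_ifs <;> simp [hj]
    · refine ENNReal.mul_ne_top (by simp) (ENNReal.sum_ne_top.2 fun x _ => ?_)
      simp only [hor]
      exact htop x _
  have hin : ∑ x ∈ Λ, ∑ y ∈ Λ, Jcoup d J α x y * (if σ x = σ y then 1 else 0) =
      ∑ x ∈ Λ, ∑ y ∈ Λ, Jcoup d J α x y -
        ∑ x ∈ Λ, ∑ y ∈ Λ, (if σ x = σ y then 0 else Jcoup d J α x y) := by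
    rw [← Finset.sum_sub_distrib]
    refine Finset.sum_congr rfl fun x _ => ?_
    rw [← Finset.sum_sub_distrib]
    refine Finset.sum_congr rfl fun y _ => ?_
    split_ifs <;> simp
  have hbd : ∑ x ∈ Λ, ∑' y : Zd d,
        (if y ∈ Λ then 0 else Jcoup d J α x y * (if σ x = n then 1 else 0)) =
      ∑ x ∈ Λ, ∑' y, (if y ∈ Λ then 0 else Jcoup d J α x y) -
        ∑ x ∈ Λ, ∑' y, (if y ∈ Λ ∨ σ x = n then 0 else Jcoup d J α x y) := by
    rw [← Finset.sum_sub_distrib]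
    refine Finset.sum_congr rfl fun x _ => ?_
    rw [← (hsum x _).tsum_sub (hsum x _)]
    refine tsum_congr fun y => ?_
    by_cases h1 : y ∈ Λ <;> by_cases h2 : σ x = n <;> simp [h1, h2]
  rw [pottsHam, hin, hbd, hE, groundEnergy]
  ring

/-! ### Isoperimetric lower bounds on the energy and the decaying field -/

lemma IsGrad.card_le_of_ne_add_ee {d q : ℕ} {γ : Finset (Edge d q)} {f : Zd d → ZMod q}
    (h : IsGrad γ f) (i : Fin d) {S : Finset (Zd d)} (hS : ∀ x ∈ S, f x ≠ f (x + ee i)) :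
    S.card ≤ γ.card := by
  refine Finset.card_le_card_of_injOn (fun x => (x, i, f (x + ee i) - f x)) (fun x hx => ?_) ?_
  · exact (h _ _ _).2 ⟨rfl, sub_ne_zero.2 (hS x hx).symm⟩
  · intro x _ y _ hxy
    exact (Prod.mk.inj hxy).1

lemma IsGrad.card_le_nm_mul {d q : ℕ} {γ : Finset (Edge d q)} {f : Zd d → ZMod q}
    (h : IsGrad γ f) (n : ℕ) : ∀ w : Zd d, nm w = n → ∀ S : Finset (Zd d),
      (∀ x ∈ S, f x ≠ f (x + w)) → S.card ≤ n * γ.card := by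
  classical
  induction n with
  | zero =>
    intro w hw S hS
    rw [nm_eq_zero] at hw
    subst hw
    have : S = ∅ := Finset.eq_empty_of_forall_notMem fun x hx => hS x hx (by simp)
    simp [this]
  | succ n ih =>
    intro w hw S hS
    have hwi : ∃ i, w i ≠ 0 := by
      by_contra! h0
      rw [(nm_eq_zero (x := w)).2 (funext h0)] at hw
      omega
    obtain ⟨i, hi⟩ := hwi
    have key : ∀ u : Zd d, nm (w - u) = n →
        (∀ T : Finset (Zd d), (∀ x ∈ T, f x ≠ f (x + u)) → T.card ≤ γ.card) →
        S.card ≤ (n + 1) * γ.card := by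
      intro u hu hT
      set S1 := S.filter fun x => f x ≠ f (x + u)
      set S2 := (S.filter fun x => ¬ f x ≠ f (x + u)).map (addRightEmbedding u) with hS2
      have h1 : S1.card ≤ γ.card := hT S1 fun x hx => (Finset.mem_filter.1 hx).2
      have h2 : S2.card ≤ n * γ.card := by
        refine ih (w - u) hu S2 fun y hy => ?_
        obtain ⟨x, hx, rfl⟩ := Finset.mem_map.1 hy
        obtain ⟨hxS, hxu⟩ := Finset.mem_filter.1 hx
        have h3 := hS x hxS
        rw [not_not.1 hxu] at h3
        simpa [add_assoc] using h3
      rw [hS2, Finset.card_map] at h2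
      have h3 : S1.card + (S.filter fun x => ¬ f x ≠ f (x + u)).card = S.card :=
        Finset.card_filter_add_card_filter_not _
      rw [add_mul, one_mul]
      omega
    have hnm : ∀ t : ℤ, (w i - t).natAbs + 1 = (w i).natAbs →
        nm (w - Pi.single i t) = n := by
      intro t ht
      have h1 : ∀ v : Zd d, nm v = (v i).natAbs + ∑ j ∈ Finset.univ.erase i, (v j).natAbs :=
        fun v => (Finset.add_sum_erase _ _ (Finset.mem_univ i)).symm
      rw [h1] at hw ⊢
      have h2 : ∑ j ∈ Finset.univ.erase i, ((w - (Pi.single i t : Zd d)) j).natAbs =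
          ∑ j ∈ Finset.univ.erase i, (w j).natAbs :=
        Finset.sum_congr rfl fun j hj => by simp [Pi.single_eq_of_ne (Finset.ne_of_mem_erase hj)]
      rw [h2]
      simp only [Pi.sub_apply, Pi.single_eq_same]
      omega
    rcases lt_or_gt_of_ne hi with hlt | hgt
    · refine key (Pi.single i (-1)) (hnm _ (by omega)) fun T hT => ?_
      rw [← Finset.card_map (addRightEmbedding (Pi.single i (-1) : Zd d))]
      refine h.card_le_of_ne_add_ee i fun y hy => ?_
      obtain ⟨x, hx, rfl⟩ := Finset.mem_map.1 hy
      have h3 := hT x hx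
      have h4 : x + Pi.single i (-1) + ee i = x := by
        rw [add_assoc, ← Pi.single_add]
        simp
      rw [addRightEmbedding_apply, h4]
      exact h3.symm
    · exact key (ee i) (hnm _ (by omega)) fun T hT => h.card_le_of_ne_add_ee i hT

lemma pow_le_two_mul_card_sdiff {d R : ℕ} {V : Finset (Zd d)}
    (hR : 2 * V.card ≤ (2 * R + 1) ^ d) (x : Zd d) :
    (2 * R + 1) ^ d ≤ 2 * (cube R x \ V).card := by
  have h := Finset.le_card_sdiff V (cube R x)
  rw [card_cube] at h
  omega

/-- A set filling at most half of each cube of radius `R` has a boundary of size at least a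
constant times its volume over `R`. -/
lemma IsGrad.card_le_mul_card {d q R : ℕ} {γ : Finset (Edge d q)} {f : Zd d → ZMod q}
    (h : IsGrad γ f) {V : Finset (Zd d)} (hV : ∀ x, f x ≠ 0 ↔ x ∈ V)
    (hR : 2 * V.card ≤ (2 * R + 1) ^ d) : V.card ≤ 2 * (d * R) * γ.card := by
  classical
  have h1 : V.card * (2 * R + 1) ^ d ≤ 2 * ∑ x ∈ V, (cube R x \ V).card := by
    rw [Finset.mul_sum, ← smul_eq_mul, ← Finset.sum_const]
    exact Finset.sum_le_sum fun x _ => pow_le_two_mul_card_sdiff hR x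
  have h2 : ∑ x ∈ V, (cube R x \ V).card =
      ∑ w ∈ cube R (0 : Zd d), (V.filter fun x => x + w ∉ V).card := by
    calc ∑ x ∈ V, (cube R x \ V).card
        = ∑ x ∈ V, ((cube R (0 : Zd d)).filter fun w => x + w ∉ V).card := by
          refine Finset.sum_congr rfl fun x _ => ?_
          have h0 : cube R x \ V = ((cube R (0 : Zd d)).filter fun w => x + w ∉ V).map
              (addLeftEmbedding x) := ?_
          · rw [h0, Finset.card_map]
          ext y
          simp only [Finset.mem_sdiff, Finset.mem_map, Finset.mem_filter, addLeftEmbedding_apply]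
          constructor
          · rintro ⟨hy, hyV⟩
            refine ⟨y - x, ⟨?_, by simpa using hyV⟩, by simp⟩
            simpa [mem_cube] using hy
          · rintro ⟨w, ⟨hw, hwV⟩, rfl⟩
            exact ⟨by simpa [mem_cube] using hw, hwV⟩
      _ = _ := by
          simp only [Finset.card_filter]
          exact Finset.sum_comm
  have h3 : ∀ w ∈ cube R (0 : Zd d), (V.filter fun x => x + w ∉ V).card ≤ d * R * γ.card := by
    intro w hw
    refine (h.card_le_nm_mul _ w rfl _ fun x hx => ?_).trans
      (Nat.mul_le_mul_right _ (by simpa using nm_le_of_mem_cube hw))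
    obtain ⟨hx1, hx2⟩ := Finset.mem_filter.1 hx
    have h4 : f (x + w) = 0 := by
      by_contra h5
      exact hx2 ((hV _).1 h5)
    rw [h4]
    exact (hV x).2 hx1
  have h4 := h1.trans (Nat.mul_le_mul_left 2 (h2.trans_le (Finset.sum_le_sum h3)))
  rw [Finset.sum_const, card_cube, smul_eq_mul] at h4
  refine Nat.le_of_mul_le_mul_right (h4.trans_eq ?_) (Nat.pow_pos (n := d) (Nat.succ_pos (2 * R)))
  ring

/-- A set filling at most half of each cube of radius `R` interacts with its complement at scale
`R`. -/
lemma ofReal_le_energy {d q R : ℕ} {J α : ℝ} (hd : 1 ≤ d) (hJ : 0 ≤ J) (hα : 0 ≤ α)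
    (hR1 : 1 ≤ R) {f : Zd d → ZMod q} {V : Finset (Zd d)} (hV : ∀ x, f x ≠ 0 ↔ x ∈ V)
    (hR : 2 * V.card ≤ (2 * R + 1) ^ d) :
    ENNReal.ofReal (J * (d : ℝ) ^ (-α) / 2 * (V.card * (R : ℝ) ^ (-(α - d)))) ≤ energy J α f := by
  classical
  have hR0 : (0 : ℝ) < R := by exact_mod_cast hR1
  have hd0 : (0 : ℝ) < d := by exact_mod_cast hd
  have hpt : ∀ x ∈ V, ∀ y ∈ cube R x \ V,
      ENNReal.ofReal (J * (d * R : ℝ) ^ (-α)) ≤ if f x = f y then 0 else jw d J α x y := by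
    intro x hx y hy
    obtain ⟨hy1, hy2⟩ := Finset.mem_sdiff.1 hy
    have hfy : f y = 0 := by
      by_contra h5
      exact hy2 ((hV _).1 h5)
    rw [if_neg (by rw [hfy]; exact (hV x).2 hx), jw]
    refine ENNReal.ofReal_le_ofReal ?_
    have hne : x ≠ y := fun h => hy2 (h ▸ hx)
    have h1 : (1 : ℝ) ≤ nm (x - y) := by exact_mod_cast one_le_nm hne
    have h2 : (nm (x - y) : ℝ) ≤ d * R := by
      rw [nm_sub_comm]
      exact_mod_cast nm_le_of_mem_cube hy1
    rw [Jcoup_eq, if_neg hne, div_eq_mul_inv, ← Real.rpow_neg (by positivity)]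
    exact mul_le_mul_of_nonneg_left
      (Real.rpow_le_rpow_of_nonpos (by linarith) h2 (by linarith)) hJ
  have hsite : ∀ x ∈ V, ENNReal.ofReal (J * (d : ℝ) ^ (-α) / 2 * (R : ℝ) ^ (-(α - d))) ≤
      siteEnergy J α f x := by
    intro x hx
    have h1 : ((2 * R + 1 : ℕ) : ℝ) ^ d ≤ 2 * ((cube R x \ V).card : ℝ) := by
      exact_mod_cast pow_le_two_mul_card_sdiff hR x
    calc ENNReal.ofReal (J * (d : ℝ) ^ (-α) / 2 * (R : ℝ) ^ (-(α - d)))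
        ≤ ENNReal.ofReal (((cube R x \ V).card : ℝ) * (J * (d * R : ℝ) ^ (-α))) := by
          refine ENNReal.ofReal_le_ofReal ?_
          rw [Real.mul_rpow hd0.le hR0.le, show -(α - d) = -α + d by ring, Real.rpow_add hR0,
            Real.rpow_natCast]
          have h2 : (R : ℝ) ^ d ≤ 2 * ((cube R x \ V).card : ℝ) := by
            refine le_trans (pow_le_pow_left₀ hR0.le ?_ d) h1
            push_cast
            linarith
          calc J * (d : ℝ) ^ (-α) / 2 * ((R : ℝ) ^ (-α) * (R : ℝ) ^ d)
              = J * (d : ℝ) ^ (-α) / 2 * (R : ℝ) ^ (-α) * (R : ℝ) ^ d := by ring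
            _ ≤ J * (d : ℝ) ^ (-α) / 2 * (R : ℝ) ^ (-α) * (2 * ((cube R x \ V).card : ℝ)) := by
                gcongr
            _ = _ := by ring
      _ = ∑ y ∈ cube R x \ V, ENNReal.ofReal (J * (d * R : ℝ) ^ (-α)) := by
          rw [Finset.sum_const, nsmul_eq_mul, ENNReal.ofReal_mul (by positivity),
            ENNReal.ofReal_natCast]
      _ ≤ ∑ y ∈ cube R x \ V, (if f x = f y then 0 else jw d J α x y) :=
          Finset.sum_le_sum (hpt x hx)
      _ ≤ siteEnergy J α f x := ENNReal.sum_le_tsum _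
  calc ENNReal.ofReal (J * (d : ℝ) ^ (-α) / 2 * (V.card * (R : ℝ) ^ (-(α - d))))
      = ∑ x ∈ V, ENNReal.ofReal (J * (d : ℝ) ^ (-α) / 2 * (R : ℝ) ^ (-(α - d))) := by
        rw [Finset.sum_const, nsmul_eq_mul, ← ENNReal.ofReal_natCast,
          ← ENNReal.ofReal_mul (by positivity)]
        congr 1
        ring
    _ ≤ ∑ x ∈ V, siteEnergy J α f x := Finset.sum_le_sum hsite
    _ ≤ energy J α f := ENNReal.sum_le_tsum _

lemma sum_cube_nm_rpow_le {d N : ℕ} {κ : ℝ} (hd : 2 ≤ d) (hκ0 : 0 < κ) (hκ1 : κ ≤ 1) :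
    ∑ x ∈ cube N (0 : Zd d), (nm x : ℝ) ^ (-κ) ≤ 2 * d * 3 ^ d * (N : ℝ) ^ ((d : ℝ) - κ) := by
  classical
  have hd2 : (2 : ℝ) ≤ d := by exact_mod_cast hd
  have hshell : ∀ R : ℕ, R < N → ∑ x ∈ cube (R + 1) (0 : Zd d), (nm x : ℝ) ^ (-κ) ≤
      ∑ x ∈ cube R (0 : Zd d), (nm x : ℝ) ^ (-κ) +
        2 * d * 3 ^ d * (N : ℝ) ^ ((d : ℝ) - κ - 1) := by
    intro R hR
    have hR0 : (0 : ℝ) < (R + 1 : ℕ) := by positivity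
    rw [← Finset.sum_sdiff (cube_mono (Nat.le_succ R) (0 : Zd d)), add_comm]
    gcongr
    have h1 : ∀ x ∈ cube (R + 1) (0 : Zd d) \ cube R 0,
        (nm x : ℝ) ^ (-κ) ≤ ((R + 1 : ℕ) : ℝ) ^ (-κ) := by
      intro x hx
      refine Real.rpow_le_rpow_of_nonpos hR0 ?_ (by linarith)
      have h2 : ¬ nm (x - 0) ≤ R := fun h => (Finset.mem_sdiff.1 hx).2 (mem_cube_of_nm_le h)
      rw [sub_zero] at h2
      exact_mod_cast (by omega : R + 1 ≤ nm x)
    have hcard : ((cube (R + 1) (0 : Zd d) \ cube R 0).card : ℝ) ≤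
        2 * d * 3 ^ d * ((R + 1 : ℕ) : ℝ) ^ (d - 1) := by
      rw [Finset.cast_card_sdiff (cube_mono (Nat.le_succ R) (0 : Zd d)), card_cube, card_cube]
      push_cast
      have h3 := (le_abs_self _).trans
        (abs_pow_sub_pow_le (2 * ((R : ℝ) + 1) + 1) (2 * (R : ℝ) + 1) d)
      refine h3.trans ?_
      rw [show 2 * ((R : ℝ) + 1) + 1 - (2 * R + 1) = 2 by ring,
        abs_of_nonneg (by norm_num : (0 : ℝ) ≤ 2),
        abs_of_nonneg (by positivity : (0 : ℝ) ≤ 2 * ((R : ℝ) + 1) + 1),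
        abs_of_nonneg (by positivity : (0 : ℝ) ≤ 2 * (R : ℝ) + 1),
        max_eq_left (by linarith), mul_assoc (2 * (d : ℝ))]
      gcongr
      calc (2 * ((R : ℝ) + 1) + 1) ^ (d - 1) ≤ (3 * ((R : ℝ) + 1)) ^ (d - 1) := by
            gcongr
            have : (0 : ℝ) ≤ R := Nat.cast_nonneg R
            linarith
        _ = 3 ^ (d - 1) * ((R : ℝ) + 1) ^ (d - 1) := mul_pow _ _ _
        _ ≤ 3 ^ d * ((R : ℝ) + 1) ^ (d - 1) := by
            gcongr
            · norm_num
            · omega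
    calc ∑ x ∈ cube (R + 1) (0 : Zd d) \ cube R 0, (nm x : ℝ) ^ (-κ)
        ≤ (cube (R + 1) (0 : Zd d) \ cube R 0).card * ((R + 1 : ℕ) : ℝ) ^ (-κ) := by
          rw [← nsmul_eq_mul]
          exact Finset.sum_le_card_nsmul _ _ _ h1
      _ ≤ 2 * d * 3 ^ d * ((R + 1 : ℕ) : ℝ) ^ (d - 1) * ((R + 1 : ℕ) : ℝ) ^ (-κ) := by gcongr
      _ = 2 * d * 3 ^ d * ((R + 1 : ℕ) : ℝ) ^ ((d : ℝ) - κ - 1) := by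
          rw [mul_assoc, ← Real.rpow_natCast _ (d - 1), ← Real.rpow_add hR0,
            Nat.cast_sub (by omega)]
          congr 2
          push_cast
          ring
      _ ≤ 2 * d * 3 ^ d * (N : ℝ) ^ ((d : ℝ) - κ - 1) := by
          refine mul_le_mul_of_nonneg_left ?_ (by positivity)
          exact Real.rpow_le_rpow hR0.le (by exact_mod_cast hR) (by linarith)
  have hind : ∀ R : ℕ, R ≤ N → ∑ x ∈ cube R (0 : Zd d), (nm x : ℝ) ^ (-κ) ≤
      R * (2 * d * 3 ^ d * (N : ℝ) ^ ((d : ℝ) - κ - 1)) := by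
    intro R
    induction R with
    | zero =>
      intro _
      have h0 : cube 0 (0 : Zd d) = {0} := by
        ext x
        simp [mem_cube, funext_iff]
      rw [h0, Finset.sum_singleton, nm_zero]
      simp [Real.zero_rpow (by linarith : -κ ≠ 0)]
    | succ R ih =>
      intro hR
      refine (hshell R hR).trans ?_
      have := ih (by omega)
      push_cast
      linarith
  rcases Nat.eq_zero_or_pos N with rfl | hN
  · refine (hind 0 le_rfl).trans ?_
    simp only [Nat.cast_zero, zero_mul]
    positivity
  · refine (hind N le_rfl).trans_eq ?_
    rw [Real.rpow_sub_one (by positivity)]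
    field_simp

/-- The weighted volume of the support is controlled by the energy. -/
theorem exists_sum_rpow_le_energy {d : ℕ} (q : ℕ) {J α : ℝ} (hd : 2 ≤ d) (hJ : 0 < J)
    (hα : (d : ℝ) < α) :
    ∃ C : ℝ, 0 < C ∧ ∀ (γ : Finset (Edge d q)) (f : Zd d → ZMod q) (V : Finset (Zd d)),
      IsGrad γ f → (∀ x, f x ≠ 0 ↔ x ∈ V) → energy J α f < ⊤ →
      ∑ x ∈ V, (nm x : ℝ) ^ (-(min (α - d) 1)) ≤ C * (energy J α f).toReal := by
  classical
  set κ := min (α - d) 1 with hκ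
  have hκ0 : 0 < κ := lt_min (by linarith) one_pos
  have hκ1 : κ ≤ 1 := min_le_right _ _
  have hα0 : 0 ≤ α := (Nat.cast_nonneg d).trans hα.le
  have hd0 : (0 : ℝ) < d := by exact_mod_cast (by omega : 0 < d)
  set c := min (J * (d : ℝ) ^ (-α) / 2) (J / (2 * d)) with hc
  have hc0 : 0 < c := lt_min (by positivity) (by positivity)
  set K : ℝ := 2 * d * 3 ^ d * 2 + 1 with hK
  have hK0 : 0 < K := by positivity
  refine ⟨K / c, by positivity, fun γ f V hγ hV htop => ?_⟩
  rcases V.eq_empty_or_nonempty with rfl | hne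
  · simp only [Finset.sum_empty]
    positivity
  have hex : ∃ R : ℕ, 2 * V.card ≤ (2 * R + 1) ^ d := by
    refine ⟨V.card, le_trans ?_ (Nat.le_self_pow (by omega) _)⟩
    omega
  set R := Nat.find hex with hRdef
  have hR : 2 * V.card ≤ (2 * R + 1) ^ d := Nat.find_spec hex
  have hVc : 1 ≤ V.card := hne.card_pos
  have hR1 : 1 ≤ R := by
    by_contra h0
    have h1 : R = 0 := by omega
    rw [h1] at hR
    simp only [mul_zero, zero_add, one_pow] at hR
    omega
  have hR0 : (0 : ℝ) < R := by exact_mod_cast hR1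
  have hRV : (R : ℝ) ^ d ≤ 2 * V.card := by
    have h1 := Nat.find_min hex (m := R - 1) (by omega)
    have h2 : R ^ d ≤ (2 * (R - 1) + 1) ^ d := Nat.pow_le_pow_left (by omega) d
    exact_mod_cast (by omega : R ^ d ≤ 2 * V.card)
  have hlow : c * (V.card * (R : ℝ) ^ (-κ)) ≤ (energy J α f).toReal := by
    rcases le_total (α - d) 1 with h | h
    · have hκ' : κ = α - d := min_eq_left h
      rw [← ENNReal.ofReal_le_iff_le_toReal htop.ne, hκ']
      refine le_trans (ENNReal.ofReal_le_ofReal ?_)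
        (ofReal_le_energy (by omega) hJ.le hα0 hR1 hV hR)
      gcongr
      exact min_le_left _ _
    · have hκ' : κ = 1 := min_eq_right h
      have h1 : (V.card : ℝ) ≤ 2 * (d * R) * γ.card := by
        exact_mod_cast hγ.card_le_mul_card hV hR
      have h2 : (γ.card : ℝ) * J ≤ (energy J α f).toReal := by
        rw [← ENNReal.ofReal_le_iff_le_toReal htop.ne, ENNReal.ofReal_mul (by positivity),
          ENNReal.ofReal_natCast]
        exact hγ.card_le_energy
      refine le_trans ?_ h2
      rw [hκ', Real.rpow_neg_one]
      calc c * ((V.card : ℝ) * (R : ℝ)⁻¹)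
          ≤ J / (2 * d) * ((2 * (d * R) * γ.card) * (R : ℝ)⁻¹) := by
            gcongr
            exact min_le_right _ _
        _ = γ.card * J := by field_simp
  have hup : ∑ x ∈ V, (nm x : ℝ) ^ (-κ) ≤ K * (V.card * (R : ℝ) ^ (-κ)) := by
    have h1 : ∑ x ∈ V, (nm x : ℝ) ^ (-κ) ≤
        ∑ x ∈ cube R (0 : Zd d), (nm x : ℝ) ^ (-κ) + V.card * (R : ℝ) ^ (-κ) := by
      rw [← Finset.sum_filter_add_sum_filter_not V fun x => x ∈ cube R 0]
      refine add_le_add ?_ ?_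
      · refine Finset.sum_le_sum_of_subset_of_nonneg (fun x hx => (Finset.mem_filter.1 hx).2) ?_
        intro x _ _
        positivity
      · refine (Finset.sum_le_card_nsmul _ _ ((R : ℝ) ^ (-κ)) fun x hx => ?_).trans ?_
        · refine Real.rpow_le_rpow_of_nonpos hR0 ?_ (by linarith)
          have h2 : ¬ nm (x - 0) ≤ R := fun h => (Finset.mem_filter.1 hx).2 (mem_cube_of_nm_le h)
          rw [sub_zero] at h2
          exact_mod_cast (by omega : R ≤ nm x)
        · rw [nsmul_eq_mul]
          gcongr
          exact Finset.filter_subset _ _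
    have h2 : (R : ℝ) ^ ((d : ℝ) - κ) ≤ 2 * V.card * (R : ℝ) ^ (-κ) := by
      rw [sub_eq_add_neg, Real.rpow_add hR0, Real.rpow_natCast]
      gcongr
    calc _ ≤ _ := h1
      _ ≤ 2 * d * 3 ^ d * (2 * V.card * (R : ℝ) ^ (-κ)) + V.card * (R : ℝ) ^ (-κ) := by
          gcongr
          refine (sum_cube_nm_rpow_le hd hκ0 hκ1).trans ?_
          gcongr
      _ = _ := by rw [hK]; ring
  calc _ ≤ _ := hup
    _ = K / c * (c * (V.card * (R : ℝ) ^ (-κ))) := by field_simp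
    _ ≤ _ := by gcongr

/-! ### Counting contours -/

lemma exists_card_contour_le {d : ℕ} (q : ℕ) [NeZero q] (hd : 2 ≤ d) {M a : ℕ} (hM : 1 ≤ M) :
    ∃ K : ℝ, 1 ≤ K ∧ ∀ (R : ℕ) (x0 : Zd d) (m : ℕ) (F : Finset (Finset (Edge d q))),
      (∀ γ ∈ F, Built edist M a γ ∧ γ.card = m ∧ ∃ f : Zd d → ZMod q, IsGrad γ f ∧
        (∀ x, x ∉ cube R 0 → f x = 0) ∧ f x0 ≠ 0) → (F.card : ℝ) ≤ K ^ m := by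
  classical
  set w : Edge d q → Edge d q → ℝ := fun e e' => ((1 + (edist e e' : ℝ)) ^ (d + 1))⁻¹ with hw
  have hsum : Summable fun z : Zd d => ((1 + (nm z : ℝ)) ^ (d + 1))⁻¹ := by
    refine (summable_nm_rpow (d := d) (s := (d + 1 : ℕ)) (by push_cast; linarith)).congr fun z => ?_
    rw [Real.rpow_neg (by positivity), Real.rpow_natCast]
  set Z : ℝ := max 1 (∑' z : Zd d, d * q * ((1 + (nm z : ℝ)) ^ (d + 1))⁻¹) with hZ
  set c : ℝ := (2 * M) ^ (2 * (d + 1)) with hc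
  set b : ℕ := a * (2 * (d + 1)) with hb
  have hM' : (1 : ℝ) ≤ M := by exact_mod_cast hM
  have hc1 : 1 ≤ c := one_le_pow₀ (by linarith)
  have hwD : ∀ (p p' : Edge d q) (n : ℕ), 1 ≤ n → edist p p' ≤ M * n ^ a →
      (c * (n : ℝ) ^ b)⁻¹ ≤ w p p' * w p' p := by
    intro p p' n hn h
    have hn' : (1 : ℝ) ≤ M * (n : ℝ) ^ a := by
      exact_mod_cast Nat.mul_pos hM (Nat.pow_pos hn)
    have h' : (edist p p' : ℝ) ≤ M * (n : ℝ) ^ a := by exact_mod_cast h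
    simp only [hw]
    rw [edist_comm p' p, ← mul_inv, ← pow_add, ← two_mul, hc, hb, pow_mul (n : ℝ), ← mul_pow]
    gcongr
    linarith
  have hwZ : ∀ (R : ℕ) (e : Edge d q), ∑ e' ∈ boxEdges d q R, w e e' ≤ Z := by
    intro R e
    refine le_trans ?_ (le_max_right _ _)
    rw [boxEdges, Finset.sum_product]
    calc ∑ x ∈ cube (R + 1) (0 : Zd d), ∑ y : Fin d × ZMod q, w e (x, y)
        = ∑ x ∈ cube (R + 1) (0 : Zd d), d * q * ((1 + (nm (e.1 - x) : ℝ)) ^ (d + 1))⁻¹ := by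
          refine Finset.sum_congr rfl fun x _ => ?_
          simp [hw, edist, ZMod.card]
      _ ≤ ∑' x, d * q * ((1 + (nm (e.1 - x) : ℝ)) ^ (d + 1))⁻¹ := by
          refine Summable.sum_le_tsum _ (fun x _ => by positivity) ?_
          exact ((Equiv.subLeft e.1).summable_iff.2 hsum).mul_left _
      _ = _ := (Equiv.subLeft e.1).tsum_eq
          fun z : Zd d => d * q * ((1 + (nm z : ℝ)) ^ (d + 1))⁻¹
  set K0 : ℝ := 2 ^ b * c * Z ^ 2 with hK0
  have hZ1 : 1 ≤ Z := le_max_left _ _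
  have hK01 : 1 ≤ K0 := one_le_mul_of_one_le_of_one_le
    (one_le_mul_of_one_le_of_one_le (one_le_pow₀ (by norm_num)) hc1) (one_le_pow₀ hZ1)
  have hd1 : (1 : ℝ) ≤ d := by exact_mod_cast (by omega : 1 ≤ d)
  have hq1 : (1 : ℝ) ≤ q := by exact_mod_cast NeZero.one_le
  have hdq : (1 : ℝ) ≤ d * q := one_le_mul_of_one_le_of_one_le hd1 hq1
  have h3 : (1 : ℝ) ≤ 3 ^ d := one_le_pow₀ (by norm_num)
  refine ⟨3 ^ d * (d * q) * K0,
    one_le_mul_of_one_le_of_one_le (one_le_mul_of_one_le_of_one_le h3 hdq) hK01, ?_⟩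
  intro R x0 m F hF
  rcases F.eq_empty_or_nonempty with rfl | hne
  · simp only [Finset.card_empty, Nat.cast_zero]
    positivity
  have hm1 : 1 ≤ m := by
    obtain ⟨γ, hγ⟩ := hne
    obtain ⟨h1, h2, -⟩ := hF γ hγ
    exact h2 ▸ h1.card_pos
  set U : Finset (Edge d q) := cube m x0 ×ˢ Finset.univ with hU
  have hcov : F ⊆ U.biUnion fun e => F.filter fun γ => e ∈ γ := by
    intro γ hγ
    obtain ⟨-, h2, f, hf, hfz, hf0⟩ := hF γ hγ
    obtain ⟨p, hp, hpx⟩ := hf.exists_near hd hfz hf0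
    rw [h2] at hpx
    exact Finset.mem_biUnion.2
      ⟨p, Finset.mem_product.2 ⟨hpx, Finset.mem_univ _⟩, Finset.mem_filter.2 ⟨hγ, hp⟩⟩
  have hUc : (U.card : ℝ) ≤ (3 ^ d * (d * q)) ^ m := by
    have h4 : U.card = (2 * m + 1) ^ d * (d * q) := by
      simp [hU, Finset.card_product, card_cube, ZMod.card]
    have h5 : ∀ k : ℕ, 2 * k + 1 ≤ 3 ^ k := by
      intro k
      induction k with
      | zero => simp
      | succ k ih => rw [pow_succ]; omega
    rw [h4]
    push_cast
    rw [mul_pow, ← pow_mul, mul_comm d m, pow_mul]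
    gcongr
    · exact_mod_cast h5 m
    · exact le_self_pow₀ hdq (by omega)
  calc (F.card : ℝ) ≤ ((U.biUnion fun e => F.filter fun γ => e ∈ γ).card : ℝ) := by
        exact_mod_cast Finset.card_le_card hcov
    _ ≤ ∑ e ∈ U, ((F.filter fun γ => e ∈ γ).card : ℝ) := by
        exact_mod_cast Finset.card_biUnion_le
    _ ≤ ∑ e ∈ U, K0 ^ m := by
        refine Finset.sum_le_sum fun e _ => ?_
        refine card_built_le (fun _ _ => by positivity) hc1 hwD (hwZ R) hZ1 e m _ fun A hA => ?_
        obtain ⟨hAF, heA⟩ := Finset.mem_filter.1 hA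
        obtain ⟨h1, h2, f, hf, hfz, -⟩ := hF A hAF
        exact ⟨h1, heA, hf.subset_boxEdges hfz, h2⟩
    _ = U.card * K0 ^ m := by rw [Finset.sum_const, nsmul_eq_mul]
    _ ≤ (3 ^ d * (d * q)) ^ m * K0 ^ m := by gcongr
    _ = _ := (mul_pow _ _ _).symm

lemma sum_pow_succ_le {r : ℝ} (hr0 : 0 ≤ r) (hr : r ≤ 1 / 5) (N : ℕ) :
    ∑ m ∈ Finset.range N, r ^ (m + 1) ≤ 1 / 4 := by
  induction N with
  | zero => norm_num
  | succ N ih =>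
    rw [Finset.sum_range_succ', zero_add, pow_one]
    have h : ∑ m ∈ Finset.range N, r ^ (m + 1 + 1) = (∑ m ∈ Finset.range N, r ^ (m + 1)) * r := by
      rw [Finset.sum_mul]
      rfl
    rw [h]
    nlinarith

lemma exists_sum_exp_le {d : ℕ} (q : ℕ) [NeZero q] (hd : 2 ≤ d) {M a : ℕ} (hM : 1 ≤ M) :
    ∃ t0 : ℝ, 0 < t0 ∧ ∀ t : ℝ, t0 ≤ t → ∀ (R : ℕ) (x0 : Zd d) (F : Finset (Finset (Edge d q))),
      (∀ γ ∈ F, Built edist M a γ ∧ ∃ f : Zd d → ZMod q, IsGrad γ f ∧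
        (∀ x, x ∉ cube R 0 → f x = 0) ∧ f x0 ≠ 0) →
      ∑ γ ∈ F, Real.exp (-(t * γ.card)) ≤ 1 / 4 := by
  classical
  obtain ⟨K, hK1, hK⟩ := exists_card_contour_le q hd (a := a) hM
  refine ⟨Real.log (5 * K), Real.log_pos (by linarith), fun t ht R x0 F hF => ?_⟩
  set r := K * Real.exp (-t) with hr
  have hr5 : r ≤ 1 / 5 := by
    have h1 : Real.exp (-t) ≤ (5 * K)⁻¹ := by
      rw [← Real.exp_log (by positivity : 0 < 5 * K), ← Real.exp_neg]
      exact Real.exp_le_exp.2 (by linarith)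
    calc r ≤ K * (5 * K)⁻¹ := by rw [hr]; gcongr
      _ = 1 / 5 := by field_simp
  set N := F.sup Finset.card with hN
  have hmaps : ∀ γ ∈ F, γ.card - 1 ∈ Finset.range N := by
    intro γ hγ
    have h1 : γ.card ≤ N := Finset.le_sup (f := Finset.card) hγ
    have h2 := (hF γ hγ).1.card_pos
    exact Finset.mem_range.2 (by omega)
  rw [← Finset.sum_fiberwise_of_maps_to hmaps]
  refine le_trans (Finset.sum_le_sum fun m _ => ?_) (sum_pow_succ_le (by positivity) hr5 N)
  have hcard : ∀ γ ∈ F.filter (fun γ => γ.card - 1 = m), γ.card = m + 1 := by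
    intro γ hγ
    obtain ⟨h1, h2⟩ := Finset.mem_filter.1 hγ
    have := (hF γ h1).1.card_pos
    omega
  calc ∑ γ ∈ F.filter (fun γ => γ.card - 1 = m), Real.exp (-(t * γ.card))
      = ∑ γ ∈ F.filter (fun γ => γ.card - 1 = m), Real.exp (-t) ^ (m + 1) := by
        refine Finset.sum_congr rfl fun γ hγ => ?_
        rw [hcard γ hγ, ← Real.exp_nat_mul]
        congr 1
        ring
    _ = (F.filter fun γ => γ.card - 1 = m).card * Real.exp (-t) ^ (m + 1) := by
        rw [Finset.sum_const, nsmul_eq_mul]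
    _ ≤ K ^ (m + 1) * Real.exp (-t) ^ (m + 1) := by
        gcongr
        refine hK R x0 (m + 1) _ fun γ hγ => ?_
        obtain ⟨h1, h2⟩ := hF γ (Finset.mem_filter.1 hγ).1
        exact ⟨h1, hcard γ hγ, h2⟩
    _ = r ^ (m + 1) := by rw [hr, mul_pow]

/-! ### The Peierls estimate -/

lemma sum_field_le {d q : ℕ} [NeZero q] {h : Zd d → ZMod q → ℝ} (h0 : ∀ x n, 0 ≤ h x n) {R1 : ℕ}
    {ε κ : ℝ} (hε : 0 ≤ ε) (hh : ∀ x, x ∉ cube R1 0 → ∀ n, h x n ≤ ε * (nm x : ℝ) ^ (-κ))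
    (V : Finset (Zd d)) (σ : Zd d → ZMod q) :
    ∑ x ∈ V, h x (σ x) ≤ ε * ∑ x ∈ V, (nm x : ℝ) ^ (-κ) +
      if ∃ x ∈ V, x ∈ cube R1 0 then ∑ x ∈ cube R1 0, ∑ n, h x n else 0 := by
  classical
  rw [← Finset.sum_filter_not_add_sum_filter V fun x => x ∈ cube R1 0, Finset.mul_sum]
  refine add_le_add ?_ ?_
  · calc ∑ x ∈ V with x ∉ cube R1 0, h x (σ x)
        ≤ ∑ x ∈ V with x ∉ cube R1 0, ε * (nm x : ℝ) ^ (-κ) :=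
          Finset.sum_le_sum fun x hx => hh x (Finset.mem_filter.1 hx).2 _
      _ ≤ ∑ x ∈ V, ε * (nm x : ℝ) ^ (-κ) :=
          Finset.sum_le_sum_of_subset_of_nonneg (Finset.filter_subset _ _)
            fun x _ _ => by positivity
  · split_ifs with hex
    · calc ∑ x ∈ V with x ∈ cube R1 0, h x (σ x)
          ≤ ∑ x ∈ V with x ∈ cube R1 0, ∑ n, h x n :=
            Finset.sum_le_sum fun x _ =>
              Finset.single_le_sum (f := h x) (fun n _ => h0 x n) (Finset.mem_univ _)
        _ ≤ ∑ x ∈ cube R1 0, ∑ n, h x n :=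
            Finset.sum_le_sum_of_subset_of_nonneg (fun x hx => (Finset.mem_filter.1 hx).2)
              fun x _ _ => Finset.sum_nonneg fun n _ => h0 x n
    · rw [Finset.sum_eq_zero]
      intro x hx
      obtain ⟨hx1, hx2⟩ := Finset.mem_filter.1 hx
      exact absurd ⟨x, hx1, hx2⟩ hex

/-- If the support of a contour function contains both a point and a remote point, the contour is
large. -/
lemma IsGrad.nm_sub_le {d q R M a : ℕ} (hd : 2 ≤ d) {γ : Finset (Edge d q)} {f : Zd d → ZMod q}
    (hB : Built edist M a γ) (ha : 1 ≤ a) (h : IsGrad γ f) (hf : ∀ x, x ∉ cube R 0 → f x = 0)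
    {x y : Zd d} (hx : f x ≠ 0) (hy : f y ≠ 0) :
    nm (x - y) ≤ 2 * (d * γ.card) + M * γ.card ^ (a + 1) := by
  obtain ⟨p, hp, hpx⟩ := h.exists_near hd hf hx
  obtain ⟨p', hp', hpy⟩ := h.exists_near hd hf hy
  have h1 : nm (p.1 - p'.1) ≤ M * γ.card ^ (a + 1) :=
    hB.diam_le ha edist_self edist_comm edist_triangle p hp p' hp'
  have h2 := nm_le_of_mem_cube hpx
  have h3 := nm_le_of_mem_cube hpy
  have h4 := PottsPeierls.nm_sub_le x p.1 y
  have h5 := PottsPeierls.nm_sub_le p.1 p'.1 y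
  rw [nm_sub_comm x p.1] at h4
  omega

/-- For a small decaying field, there is a site such that every configuration disagreeing there
with the constant boundary condition admits a contour around that site whose erasure lowers the
Hamiltonian by a multiple of the size of the contour. -/
theorem exists_pottsHam_sub_le {d : ℕ} (q : ℕ) [NeZero q] {J α : ℝ} (hd : 2 ≤ d) (hJ : 0 < J)
    (hα : (d : ℝ) < α) :
    ∃ (M a : ℕ) (ε : ℝ), 1 ≤ M ∧ 0 < ε ∧ ∀ (h : Zd d → ZMod q → ℝ) (R1 : ℕ),
      (∀ x n, 0 ≤ h x n) →
      (∀ x, x ∉ cube R1 0 → ∀ n, h x n ≤ ε * (nm x : ℝ) ^ (-(min (α - d) 1))) →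
      ∃ x0 : Zd d, ∀ (R : ℕ) (n : ZMod q) (σ : Zd d → ZMod q),
        (∀ x, x ∉ cube R 0 → σ x = n) → σ x0 ≠ n →
        ∃ (γ : Finset (Edge d q)) (g : Zd d → ZMod q),
          Built edist M a γ ∧ IsGrad γ g ∧ (∀ x, x ∉ cube R 0 → g x = 0) ∧ g x0 ≠ 0 ∧
          pottsHam d q (Jcoup d J α) h (cube R 0) (fun _ => n) (σ - g) + J / 8 * γ.card ≤
            pottsHam d q (Jcoup d J α) h (cube R 0) (fun _ => n) σ := by
  classical
  obtain ⟨M, a, hM, ha, herase⟩ := exists_energy_erase_le q hd hJ hα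
  obtain ⟨C, hC0, hC⟩ := exists_sum_rpow_le_energy q hd hJ hα
  set κ := min (α - d) 1
  refine ⟨M, a, (16 * C)⁻¹, by omega, by positivity, fun h R1 h0 hh => ?_⟩
  set A := ∑ x ∈ cube R1 (0 : Zd d), ∑ n, h x n with hA
  obtain ⟨m0, hm0⟩ := exists_nat_ge (16 * A / J)
  rw [div_le_iff₀ hJ] at hm0
  refine ⟨Pi.single ⟨0, by omega⟩
    ((d * R1 + 2 * (d * m0) + M * m0 ^ (a + 1) + 1 : ℕ) : ℤ), fun R n σ hσ hne => ?_⟩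
  set x0 : Zd d := Pi.single ⟨0, by omega⟩
    ((d * R1 + 2 * (d * m0) + M * m0 ^ (a + 1) + 1 : ℕ) : ℤ) with hx0
  have hx0n : nm x0 = d * R1 + 2 * (d * m0) + M * m0 ^ (a + 1) + 1 := by
    rw [hx0, nm_single, Int.natAbs_natCast]
  set f : Zd d → ZMod q := fun x => σ x - n with hf
  have hfz : ∀ x, x ∉ cube R 0 → f x = 0 := fun x hx => sub_eq_zero.2 (hσ x hx)
  obtain ⟨P, g, hP, hsep, hfP⟩ := exists_contours (M := M) (a := a) hd hM hfz
  have hfx0 : ∑ γ ∈ P, g γ x0 ≠ 0 := by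
    rw [← Finset.sum_apply, ← hfP]
    exact sub_ne_zero.2 hne
  obtain ⟨γ, hγ, hgx0⟩ := Finset.exists_ne_zero_of_sum_ne_zero hfx0
  obtain ⟨hB, hG, hz⟩ := hP γ hγ
  refine ⟨γ, g γ, hB, hG, hz, hgx0, ?_⟩
  set Φ := (energy J α (g γ)).toReal with hΦ
  have hΦtop : energy J α (g γ) < ⊤ := energy_lt_top hJ.le hα hz
  have hσz : ∀ x, x ∉ cube R 0 → (σ - g γ) x = n := by
    intro x hx
    rw [Pi.sub_apply, hσ x hx, hz x hx, sub_zero]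
  have hE : (energy J α (σ - g γ)).toReal + 1 / 2 * Φ ≤ (energy J α σ).toReal := by
    have h1 := herase R P g hP hsep γ hγ
    rw [Finset.sum_erase_eq_sub hγ, ← hfP] at h1
    have h2 : energy J α σ = energy J α f := by
      rw [← energy_add_const J α f n]
      simp [hf]
    have h3 : energy J α (σ - g γ) = energy J α (f - g γ) := by
      rw [← energy_add_const J α (f - g γ) n]
      congr 1
      ext1 x
      simp only [hf, Pi.sub_apply]
      ring
    have hftop : energy J α f < ⊤ := energy_lt_top hJ.le hα hfz
    have hfgtop : energy J α (f - g γ) < ⊤ := by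
      refine energy_lt_top (R := R) hJ.le hα fun x hx => ?_
      rw [Pi.sub_apply, hfz x hx, hz x hx, sub_zero]
    rw [h2, h3]
    have h4 := ENNReal.toReal_mono hftop.ne h1
    rwa [ENNReal.toReal_add hfgtop.ne (ENNReal.mul_lt_top (by simp) hΦtop).ne,
      ENNReal.toReal_mul, ENNReal.toReal_ofReal (by norm_num)] at h4
  have hΦm : J * γ.card ≤ Φ := by
    rw [hΦ, ← ENNReal.ofReal_le_iff_le_toReal hΦtop.ne, mul_comm,
      ENNReal.ofReal_mul (by positivity), ENNReal.ofReal_natCast]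
    exact hG.card_le_energy
  have hΦ0 : 0 ≤ Φ := ENNReal.toReal_nonneg
  set V := (cube R (0 : Zd d)).filter fun x => g γ x ≠ 0 with hVdef
  have hV : ∀ x, g γ x ≠ 0 ↔ x ∈ V := by
    intro x
    rw [hVdef, Finset.mem_filter, iff_and_self]
    intro hx
    by_contra hxc
    exact hx (hz x hxc)
  have hfield : ∑ x ∈ cube R (0 : Zd d), h x (σ x) - ∑ x ∈ cube R (0 : Zd d), h x ((σ - g γ) x) ≤
      ∑ x ∈ V, h x (σ x) := by
    rw [← Finset.sum_sub_distrib, hVdef, Finset.sum_filter]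
    refine Finset.sum_le_sum fun x _ => ?_
    split_ifs with hx
    · have := h0 x ((σ - g γ) x)
      linarith
    · rw [not_not] at hx
      simp [hx]
  have hloss : ∑ x ∈ V, h x (σ x) ≤ Φ / 8 := by
    refine (sum_field_le h0 (by positivity) hh V σ).trans ?_
    have h1 : (16 * C)⁻¹ * ∑ x ∈ V, (nm x : ℝ) ^ (-κ) ≤ Φ / 16 := by
      calc (16 * C)⁻¹ * ∑ x ∈ V, (nm x : ℝ) ^ (-κ) ≤ (16 * C)⁻¹ * (C * Φ) := by
            gcongr
            exact hC γ (g γ) V hG hV hΦtop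
        _ = Φ / 16 := by field_simp
    have h2 : (if ∃ x ∈ V, x ∈ cube R1 0 then A else 0) ≤ Φ / 16 := by
      split_ifs with hex
      · obtain ⟨y, hyV, hy⟩ := hex
        have h3 := IsGrad.nm_sub_le hd hB ha hG hz hgx0 ((hV y).2 hyV)
        have h4 : m0 ≤ γ.card := by
          by_contra hlt
          have h5 : γ.card ≤ m0 := by omega
          have h6 : 2 * (d * γ.card) + M * γ.card ^ (a + 1) ≤
              2 * (d * m0) + M * m0 ^ (a + 1) := by gcongr
          have h7 := PottsPeierls.nm_sub_le x0 y 0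
          have h8 := nm_le_of_mem_cube hy
          rw [sub_zero, sub_zero] at h7
          rw [sub_zero] at h8
          omega
        have h5 : (m0 : ℝ) * J ≤ γ.card * J := by gcongr
        linarith
      · positivity
    linarith
  rw [pottsHam_eq hJ.le hα h hσ, pottsHam_eq hJ.le hα h hσz]
  linarith

/-! ### Gibbs measures and their cluster points -/

lemma pottsWeight_nonneg {d q : ℕ} [NeZero q] (Jc : Zd d → Zd d → ℝ) (β : ℝ)
    (h : Zd d → ZMod q → ℝ) (Λ : Finset (Zd d)) (η : Zd d → ZMod q) (σ : Λ → ZMod q) :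
    0 ≤ pottsWeight d q Jc β h Λ η σ := by
  unfold pottsWeight
  positivity

lemma extendCfg_sub {d q : ℕ} {Λ : Finset (Zd d)} {g : Zd d → ZMod q} (hg : ∀ x, x ∉ Λ → g x = 0)
    (η : Zd d → ZMod q) (ω : Λ → ZMod q) :
    extendCfg Λ η (ω - fun x : Λ => g x) = extendCfg Λ η ω - g := by
  funext x
  by_cases hx : x ∈ Λ
  · simp [extendCfg, hx]
  · simp [extendCfg, hx, hg x hx]

/-- If subtracting `g` lowers the energy by at least `E`, the weight grows by a factor
`exp (β E)`. -/
lemma pottsWeight_le_of_pottsHam_sub_le {d q : ℕ} [NeZero q] {Jc : Zd d → Zd d → ℝ} {β : ℝ}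
    (hβ : 0 ≤ β) {h : Zd d → ZMod q → ℝ} {Λ : Finset (Zd d)} {η : Zd d → ZMod q}
    {g : Zd d → ZMod q} (hg : ∀ x, x ∉ Λ → g x = 0) {E : ℝ} {ω : Λ → ZMod q}
    (hω : pottsHam d q Jc h Λ η (extendCfg Λ η ω - g) + E ≤
      pottsHam d q Jc h Λ η (extendCfg Λ η ω)) :
    pottsWeight d q Jc β h Λ η ω ≤
      Real.exp (-(β * E)) * pottsWeight d q Jc β h Λ η (ω - fun x : Λ => g x) := by
  unfold pottsWeight
  rw [extendCfg_sub hg, ← mul_div_assoc, ← Real.exp_add]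
  refine div_le_div_of_nonneg_right (Real.exp_le_exp.2 ?_) (by positivity)
  nlinarith [mul_le_mul_of_nonneg_left hω hβ]

/-- The total weight of the configurations whose energy drops by at least `E` when `g` is
subtracted. -/
lemma sum_pottsWeight_filter_le {d q : ℕ} [NeZero q] {Jc : Zd d → Zd d → ℝ} {β : ℝ}
    (hβ : 0 ≤ β) (h : Zd d → ZMod q → ℝ) {Λ : Finset (Zd d)} (η : Zd d → ZMod q)
    {g : Zd d → ZMod q} (hg : ∀ x, x ∉ Λ → g x = 0) (E : ℝ) (s : Finset (Λ → ZMod q))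
    (hs : ∀ ω ∈ s, pottsHam d q Jc h Λ η (extendCfg Λ η ω - g) + E ≤
      pottsHam d q Jc h Λ η (extendCfg Λ η ω)) :
    ∑ ω ∈ s, pottsWeight d q Jc β h Λ η ω ≤ Real.exp (-(β * E)) := by
  calc ∑ ω ∈ s, pottsWeight d q Jc β h Λ η ω
      ≤ ∑ ω ∈ s, Real.exp (-(β * E)) * pottsWeight d q Jc β h Λ η (ω - fun x : Λ => g x) :=
        Finset.sum_le_sum fun ω hω => pottsWeight_le_of_pottsHam_sub_le hβ hg (hs ω hω)
    _ ≤ ∑ ω, Real.exp (-(β * E)) * pottsWeight d q Jc β h Λ η (ω - fun x : Λ => g x) :=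
        Finset.sum_le_sum_of_subset_of_nonneg (Finset.subset_univ _) fun ω _ _ =>
          mul_nonneg (Real.exp_pos _).le (pottsWeight_nonneg _ _ _ _ _ _)
    _ = Real.exp (-(β * E)) := by
        have hshift := (Equiv.subRight fun x : Λ => g x).sum_comp (pottsWeight d q Jc β h Λ η)
        simp only [Equiv.subRight_apply] at hshift
        rw [← Finset.mul_sum, hshift, pottsWeight_sum, mul_one]

/-- The Peierls estimate: a deviation from the boundary condition at `x0` is unlikely. -/
lemma sum_pottsWeight_ne_le {d q : ℕ} [NeZero q] (hd : 2 ≤ d) {Jc : Zd d → Zd d → ℝ}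
    {h : Zd d → ZMod q → ℝ} {M a R : ℕ} {x0 : Zd d} {n : ZMod q} {β J t : ℝ} (hβ : 0 ≤ β)
    (ht : β * (J / 8) = t)
    (hsum : ∀ F : Finset (Finset (Edge d q)), (∀ γ ∈ F, Built edist M a γ ∧ ∃ f, IsGrad γ f ∧
      (∀ x, x ∉ cube R 0 → f x = 0) ∧ f x0 ≠ 0) → ∑ γ ∈ F, Real.exp (-(t * γ.card)) ≤ 1 / 4)
    (hham : ∀ σ : Zd d → ZMod q, (∀ x, x ∉ cube R 0 → σ x = n) → σ x0 ≠ n →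
      ∃ (γ : Finset (Edge d q)) (g : Zd d → ZMod q),
        Built edist M a γ ∧ IsGrad γ g ∧ (∀ x, x ∉ cube R 0 → g x = 0) ∧ g x0 ≠ 0 ∧
        pottsHam d q Jc h (cube R 0) (fun _ => n) (σ - g) + J / 8 * γ.card ≤
          pottsHam d q Jc h (cube R 0) (fun _ => n) σ) :
    ∑ ω : (cube R (0 : Zd d)) → ZMod q with extendCfg (cube R 0) (fun _ => n) ω x0 ≠ n,
      pottsWeight d q Jc β h (cube R 0) (fun _ => n) ω ≤ 1 / 4 := by
  classical
  set F : Finset (Finset (Edge d q)) := (boxEdges d q R).powerset.filter fun γ =>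
    Built edist M a γ ∧ ∃ f, IsGrad γ f ∧ (∀ x, x ∉ cube R 0 → f x = 0) ∧ f x0 ≠ 0 with hF
  have hFp : ∀ γ ∈ F, Built edist M a γ ∧ ∃ f, IsGrad γ f ∧
      (∀ x, x ∉ cube R 0 → f x = 0) ∧ f x0 ≠ 0 := fun γ hγ => (Finset.mem_filter.1 hγ).2
  have hG : ∀ γ, ∃ f : Zd d → ZMod q, γ ∈ F → IsGrad γ f ∧ (∀ x, x ∉ cube R 0 → f x = 0) := by
    intro γ
    by_cases hγ : γ ∈ F
    · obtain ⟨-, f, hf, hf0, -⟩ := hFp γ hγ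
      exact ⟨f, fun _ => ⟨hf, hf0⟩⟩
    · exact ⟨0, fun h => absurd h hγ⟩
  choose G hG using hG
  set w := pottsWeight d q Jc β h (cube R 0) (fun _ => n) with hw
  set B : Finset (Edge d q) → Finset ((cube R (0 : Zd d)) → ZMod q) := fun γ =>
    Finset.univ.filter fun ω =>
      pottsHam d q Jc h (cube R 0) (fun _ => n) (extendCfg (cube R 0) (fun _ => n) ω - G γ) +
        J / 8 * γ.card ≤
      pottsHam d q Jc h (cube R 0) (fun _ => n) (extendCfg (cube R 0) (fun _ => n) ω) with hB
  have hcov : (Finset.univ.filter fun ω : (cube R (0 : Zd d)) → ZMod q =>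
      extendCfg (cube R 0) (fun _ => n) ω x0 ≠ n) ⊆ F.biUnion B := by
    intro ω hω
    obtain ⟨γ, g, hb, hg, hg0, hgx, hle⟩ := hham (extendCfg (cube R 0) (fun _ => n) ω)
      (fun x hx => by simp [extendCfg, hx]) (Finset.mem_filter.1 hω).2
    have hγ : γ ∈ F := Finset.mem_filter.2
      ⟨Finset.mem_powerset.2 (hg.subset_boxEdges hg0), hb, g, hg, hg0, hgx⟩
    have hgG : G γ = g := IsGrad.unique hd (hG γ hγ).1 hg (hG γ hγ).2 hg0
    refine Finset.mem_biUnion.2 ⟨γ, hγ, Finset.mem_filter.2 ⟨Finset.mem_univ _, ?_⟩⟩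
    rw [hgG]
    exact hle
  have hw0 : ∀ ω, 0 ≤ w ω := pottsWeight_nonneg _ _ _ _ _
  calc _ ≤ ∑ ω ∈ F.biUnion B, w ω :=
        Finset.sum_le_sum_of_subset_of_nonneg hcov fun ω _ _ => hw0 ω
    _ ≤ ∑ ω ∈ F.biUnion B, ∑ γ ∈ F, if ω ∈ B γ then w ω else 0 := by
        refine Finset.sum_le_sum fun ω hω => ?_
        obtain ⟨γ, hγ, hωγ⟩ := Finset.mem_biUnion.1 hω
        refine le_trans (by rw [if_pos hωγ]) (Finset.single_le_sum
          (f := fun γ => if ω ∈ B γ then w ω else 0) (fun γ _ => ?_) hγ)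
        split_ifs <;> simp [hw0]
    _ ≤ ∑ ω, ∑ γ ∈ F, if ω ∈ B γ then w ω else 0 := by
        refine Finset.sum_le_sum_of_subset_of_nonneg (Finset.subset_univ _) fun ω _ _ =>
          Finset.sum_nonneg fun γ _ => ?_
        split_ifs <;> simp [hw0]
    _ = ∑ γ ∈ F, ∑ ω ∈ B γ, w ω := by
        rw [Finset.sum_comm]
        simp
    _ ≤ ∑ γ ∈ F, Real.exp (-(t * γ.card)) := by
        refine Finset.sum_le_sum fun γ hγ => ?_
        rw [← ht, mul_assoc]
        exact sum_pottsWeight_filter_le hβ h _ (hG γ hγ).2 _ _ fun ω hω =>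
          (Finset.mem_filter.1 hω).2
    _ ≤ 1 / 4 := hsum F hFp

lemma isClopen_setOf_apply_ne {d q : ℕ} (x0 : Zd d) (n : ZMod q) :
    IsClopen {σ : Zd d → ZMod q | σ x0 ≠ n} :=
  (isClopen_discrete {m : ZMod q | m ≠ n}).preimage (continuous_apply x0)

lemma pottsGibbsPM_apply_ne {d q : ℕ} [NeZero q] (Jc : Zd d → Zd d → ℝ) (β : ℝ)
    (h : Zd d → ZMod q → ℝ) (Λ : Finset (Zd d)) (η : Zd d → ZMod q) (x0 : Zd d) (n : ZMod q) :
    (pottsGibbsPM d q Jc β h Λ η : Measure (Zd d → ZMod q)) {σ | σ x0 ≠ n} =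
      ENNReal.ofReal (∑ ω : Λ → ZMod q with extendCfg Λ η ω x0 ≠ n,
        pottsWeight d q Jc β h Λ η ω) := by
  have hS : MeasurableSet {σ : Zd d → ZMod q | σ x0 ≠ n} :=
    (isClopen_setOf_apply_ne x0 n).isOpen.measurableSet
  rw [ENNReal.ofReal_sum_of_nonneg fun σ _ => pottsWeight_nonneg _ _ _ _ _ _, Finset.sum_filter]
  simp only [pottsGibbsPM, ProbabilityMeasure.coe_mk, Measure.coe_finsetSum, Finset.sum_apply,
    Measure.smul_apply, smul_eq_mul, Measure.dirac_apply' _ hS, Set.indicator_apply,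
    Set.mem_ofPred_eq, Pi.one_apply, mul_ite, mul_one, mul_zero]

lemma tendsto_cube_atTop (d : ℕ) : Tendsto (fun R : ℕ => cube R (0 : Zd d)) atTop atTop := by
  refine tendsto_atTop.2 fun s => ?_
  filter_upwards [eventually_ge_atTop (s.sup nm)] with R hR x hx
  refine mem_cube_of_nm_le ?_
  rw [sub_zero]
  exact (Finset.le_sup hx).trans hR

/-- A uniform bound on cubes passes to some cluster point of the Gibbs measures. -/
lemma exists_mem_gibbsClusterSet_le {d q : ℕ} [NeZero q] (Jc : Zd d → Zd d → ℝ) (β : ℝ)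
    (h : Zd d → ZMod q → ℝ) (x0 : Zd d) (n : ZMod q) {c : ENNReal}
    (hc : ∀ R : ℕ, (pottsGibbsPM d q Jc β h (cube R 0) (fun _ => n) :
      Measure (Zd d → ZMod q)) {σ | σ x0 ≠ n} ≤ c) :
    ∃ μ ∈ gibbsClusterSet d q Jc β h, (μ : Measure (Zd d → ZMod q)) {σ | σ x0 ≠ n} ≤ c := by
  obtain ⟨μ, hμ⟩ := exists_clusterPt_of_compactSpace
    (map (fun R : ℕ => pottsGibbsPM d q Jc β h (cube R 0) (fun _ => n)) atTop)
  have hμ' : MapClusterPt μ atTop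
    (fun R : ℕ => pottsGibbsPM d q Jc β h (cube R 0) (fun _ => n)) := hμ
  refine ⟨μ, ⟨fun _ => n, MapClusterPt.of_comp (tendsto_cube_atTop d) hμ'⟩, ?_⟩
  by_contra! hlt
  have htend : Tendsto (fun ν : ProbabilityMeasure (Zd d → ZMod q) =>
      (ν : Measure (Zd d → ZMod q)) {σ | σ x0 ≠ n}) (nhds μ)
      (nhds ((μ : Measure (Zd d → ZMod q)) {σ | σ x0 ≠ n})) :=
    by
    simpa using ENNReal.tendsto_coe.2
      (ProbabilityMeasure.tendsto_measure_of_isClopen_of_tendsto tendsto_id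
        (isClopen_setOf_apply_ne x0 n))
  obtain ⟨R, hR⟩ := (hμ'.frequently (htend.eventually_const_lt hlt)).exists
  exact (hc R).not_gt hR

/-- A Peierls-type energy bound for every constant boundary condition yields two distinct
Gibbs measures at low temperature. -/
lemma exists_ne_mem_gibbsClusterSet {d q : ℕ} [NeZero q] (hd : 2 ≤ d) (hq : 2 ≤ q)
    {Jc : Zd d → Zd d → ℝ} {h : Zd d → ZMod q → ℝ} {M a : ℕ} {x0 : Zd d} {J t0 : ℝ} (hJ : 0 < J)
    (ht0 : 0 < t0)
    (hsum : ∀ t : ℝ, t0 ≤ t → ∀ (R : ℕ) (x0 : Zd d) (F : Finset (Finset (Edge d q))),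
      (∀ γ ∈ F, Built edist M a γ ∧ ∃ f, IsGrad γ f ∧
        (∀ x, x ∉ cube R 0 → f x = 0) ∧ f x0 ≠ 0) → ∑ γ ∈ F, Real.exp (-(t * γ.card)) ≤ 1 / 4)
    (hham : ∀ (R : ℕ) (n : ZMod q) (σ : Zd d → ZMod q),
      (∀ x, x ∉ cube R 0 → σ x = n) → σ x0 ≠ n →
      ∃ (γ : Finset (Edge d q)) (g : Zd d → ZMod q),
        Built edist M a γ ∧ IsGrad γ g ∧ (∀ x, x ∉ cube R 0 → g x = 0) ∧ g x0 ≠ 0 ∧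
        pottsHam d q Jc h (cube R 0) (fun _ => n) (σ - g) + J / 8 * γ.card ≤
          pottsHam d q Jc h (cube R 0) (fun _ => n) σ) :
    ∃ β₀ : ℝ, 0 < β₀ ∧ ∀ β : ℝ, β₀ < β → ∃ μ₁ μ₂ : ProbabilityMeasure (Zd d → ZMod q),
      μ₁ ∈ gibbsClusterSet d q Jc β h ∧ μ₂ ∈ gibbsClusterSet d q Jc β h ∧ μ₁ ≠ μ₂ := by
  refine ⟨8 * t0 / J, by positivity, fun β hβ => ?_⟩
  have hβ0 : 0 ≤ β := (show (0 : ℝ) ≤ 8 * t0 / J by positivity).trans hβ.le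
  have ht : t0 ≤ β * (J / 8) := by
    rw [div_lt_iff₀ hJ] at hβ
    linarith
  have key : ∀ n : ZMod q, ∃ μ ∈ gibbsClusterSet d q Jc β h,
      (μ : Measure (Zd d → ZMod q)) {σ | σ x0 ≠ n} ≤ ENNReal.ofReal (1 / 4) := fun n => by
    refine exists_mem_gibbsClusterSet_le Jc β h x0 n fun R => ?_
    rw [pottsGibbsPM_apply_ne]
    exact ENNReal.ofReal_le_ofReal
      (sum_pottsWeight_ne_le hd hβ0 rfl (hsum _ ht R x0) (hham R n))
  obtain ⟨μ₀, h₀, hle₀⟩ := key 0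
  obtain ⟨μ₁, h₁, hle₁⟩ := key 1
  refine ⟨μ₀, μ₁, h₀, h₁, ?_⟩
  rintro rfl
  have : Fact (1 < q) := ⟨hq⟩
  have huniv : (Set.univ : Set (Zd d → ZMod q)) ⊆ {σ | σ x0 ≠ 0} ∪ {σ | σ x0 ≠ 1} := by
    intro σ _
    by_cases hσ : σ x0 = 0
    · right
      simp [hσ]
    · exact Or.inl hσ
  have hle : (1 : ENNReal) ≤ ENNReal.ofReal (1 / 4) + ENNReal.ofReal (1 / 4) :=
    calc (1 : ENNReal) = (μ₀ : Measure (Zd d → ZMod q)) Set.univ := measure_univ.symm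
      _ ≤ _ := (measure_mono huniv).trans (measure_union_le _ _)
      _ ≤ _ := add_le_add hle₀ hle₁
  rw [← ENNReal.ofReal_add (by norm_num) (by norm_num), ← ENNReal.ofReal_one,
    ENNReal.ofReal_le_ofReal_iff (by norm_num)] at hle
  norm_num at hle

/-- Far from the origin a faster decaying power is below any multiple of a slower one. -/
lemma exists_div_rpow_le {δ κ ε : ℝ} (hδ : κ < δ) (hε : 0 < ε) (c : ℝ) :
    ∃ R : ℕ, 1 ≤ R ∧ ∀ m : ℕ, R ≤ m → c / (m : ℝ) ^ δ ≤ ε * (m : ℝ) ^ (-κ) := by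
  have h1 : Tendsto (fun m : ℕ => ε * (m : ℝ) ^ (δ - κ)) atTop atTop :=
    ((tendsto_rpow_atTop (sub_pos.2 hδ)).comp tendsto_natCast_atTop_atTop).const_mul_atTop hε
  obtain ⟨R, hR⟩ := eventually_atTop.1 (h1.eventually_ge_atTop c)
  refine ⟨max R 1, le_max_right _ _, fun m hm => ?_⟩
  have hm0 : (0 : ℝ) < m := by
    exact_mod_cast (le_max_right R 1).trans hm
  rw [div_le_iff₀ (by positivity), mul_assoc, ← Real.rpow_add hm0, neg_add_eq_sub]
  exact hR m ((le_max_left _ _).trans hm)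

end PottsPeierls

/-- **Phase transition for the long-range Potts model with a decaying field**
(Theorem 1.3). (i) If the nonnegative field `h` is bounded by `h*/|x|^δ` with
`δ > min(α-d,1)`, then for `β` large enough the set `𝒢_{β,h}` of weak cluster points
of finite-volume Gibbs measures contains two distinct measures. (ii) If the decay
exponent is exactly `min(α-d,1)`, the same holds provided `h*` is small enough. -/
theorem potts_decaying_field_long_range
    (d q : ℕ) (hd : 2 ≤ d) [NeZero q] (hq : 2 ≤ q)
    (α J : ℝ) (hα : (d : ℝ) < α) (hJ : 0 < J) :
    ((∀ h : Zd d → ZMod q → ℝ, (∀ x n, 0 ≤ h x n) →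
      ∀ hstar : ℝ, 0 ≤ hstar → ∀ δ : ℝ, min (α - d) 1 < δ →
      (∀ x : Zd d, x ≠ 0 → ∀ n : ZMod q, h x n ≤ hstar / (l1 x : ℝ) ^ δ) →
      ∃ β₀ : ℝ, 0 < β₀ ∧ ∀ β : ℝ, β₀ < β →
        ∃ μ₁ μ₂ : ProbabilityMeasure (Zd d → ZMod q),
          μ₁ ∈ gibbsClusterSet d q (Jcoup d J α) β h ∧
          μ₂ ∈ gibbsClusterSet d q (Jcoup d J α) β h ∧ μ₁ ≠ μ₂)
    ∧
    (∃ h₀ : ℝ, 0 < h₀ ∧ ∀ h : Zd d → ZMod q → ℝ, (∀ x n, 0 ≤ h x n) →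
      ∀ hstar : ℝ, 0 ≤ hstar → hstar ≤ h₀ →
      (∀ x : Zd d, x ≠ 0 → ∀ n : ZMod q, h x n ≤ hstar / (l1 x : ℝ) ^ (min (α - d) 1)) →
      ∃ β₀ : ℝ, 0 < β₀ ∧ ∀ β : ℝ, β₀ < β →
        ∃ μ₁ μ₂ : ProbabilityMeasure (Zd d → ZMod q),
          μ₁ ∈ gibbsClusterSet d q (Jcoup d J α) β h ∧
          μ₂ ∈ gibbsClusterSet d q (Jcoup d J α) β h ∧ μ₁ ≠ μ₂)) := by
  obtain ⟨M, a, ε, hM, hε, key⟩ := PottsPeierls.exists_pottsHam_sub_le q hd hJ hα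
  obtain ⟨t0, ht0, hsum⟩ := PottsPeierls.exists_sum_exp_le q hd (a := a) hM
  refine ⟨fun h h0 hstar _ δ hδ hle => ?_, ε, hε, fun h h0 hstar _ hsmall hle => ?_⟩
  · obtain ⟨R1, hR1, hdec⟩ := PottsPeierls.exists_div_rpow_le hδ hε hstar
    obtain ⟨x0, hx0⟩ := key h R1 h0 fun x hx n => by
      have hR : R1 < PottsPeierls.nm x := by
        by_contra! hlt
        exact hx (PottsPeierls.mem_cube_of_nm_le (by rwa [sub_zero]))
      have hxne : x ≠ 0 := by
        rintro rfl
        exact hx (PottsPeierls.self_mem_cube _ _)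
      refine (hle x hxne n).trans ?_
      rw [PottsPeierls.l1_eq_nm, Int.cast_natCast]
      exact hdec _ hR.le
    exact PottsPeierls.exists_ne_mem_gibbsClusterSet hd hq hJ ht0 hsum hx0
  · obtain ⟨x0, hx0⟩ := key h 0 h0 fun x hx n => by
      have hxne : x ≠ 0 := by
        rintro rfl
        exact hx (PottsPeierls.self_mem_cube _ _)
      refine (hle x hxne n).trans ?_
      rw [PottsPeierls.l1_eq_nm, Int.cast_natCast, div_eq_mul_inv,
        ← Real.rpow_neg (Nat.cast_nonneg _)]
      gcongr
    exact PottsPeierls.exists_ne_mem_gibbsClusterSet hd hq hJ ht0 hsum hx0
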